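/- arXiv:1507.06640 — 9 statements merged into one kernel-verified Lean document; each statement's English description precedes it below -/
import Mathlib

section
/- Let B be a positive real number and let f : ℝ × ℝ → ℝ be continuous and bounded on [0,B) × [0,B). Then for every α with 0 ≤ α < B, the double integral of f over the square [0,α] × [0,α] satisfies ∫₀^α ∫₀^α f(x,y) dx dy = ∫₀^1 (∫₀^α β·(f(β, βx) + f(βx, β)) dβ) dx. -/
open MeasureTheory

/-- The integral of a continuous function over the part of a square below the diagonal,
with or without (part of) the diagonal, in the coordinates `(b, x) ↦ (b, b * x)`. -/
theorem setIntegral_indicator_below_diagonal {g : ℝ × ℝ → ℝ} (hg : Continuous g) {α : ℝ}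
    {T : Set (ℝ × ℝ)} (hT : MeasurableSet T) (hlt : ∀ p : ℝ × ℝ, p.2 < p.1 → p ∈ T)
    (hle : ∀ p ∈ T, p.2 ≤ p.1) :
    ∫ p in Set.Icc (0:ℝ) α ×ˢ Set.Icc (0:ℝ) α, T.indicator g p
      = ∫ x in Set.Icc (0:ℝ) 1, ∫ b in Set.Icc (0:ℝ) α, b * g (b, b * x) := by
  have hint : IntegrableOn g (Set.Icc (0:ℝ) α ×ˢ Set.Icc (0:ℝ) α) :=
    hg.continuousOn.integrableOn_compact (isCompact_Icc.prod isCompact_Icc)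
  have hk : Continuous fun p : ℝ × ℝ => p.2 * g (p.2, p.2 * p.1) := by fun_prop
  have hint' : IntegrableOn (fun p : ℝ × ℝ => p.2 * g (p.2, p.2 * p.1))
      (Set.Icc (0:ℝ) 1 ×ˢ Set.Icc (0:ℝ) α) :=
    hk.continuousOn.integrableOn_compact (isCompact_Icc.prod isCompact_Icc)
  rw [Measure.volume_eq_prod] at *
  rw [setIntegral_prod _ (hint.indicator hT)]
  rw [integral_integral_swap (f := fun x b => b * g (b, b * x))
    (by rw [Measure.prod_restrict]; exact hint')]
  refine setIntegral_congr_fun measurableSet_Icc fun b hb => ?_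
  have hae : (fun y => T.indicator g (b, y)) =ᵐ[volume.restrict (Set.Icc 0 α)]
      (Set.Iic b).indicator fun y => g (b, y) := by
    filter_upwards [ae_restrict_of_ae (Measure.ae_ne volume b)] with y hy
    by_cases h : y ≤ b
    · rw [Set.indicator_of_mem (hlt (b, y) (lt_of_le_of_ne h hy)),
        Set.indicator_of_mem (Set.mem_Iic.2 h)]
    · rw [Set.indicator_of_notMem fun h' => h (hle _ h'), Set.indicator_of_notMem (by simpa using h)]
  have hset : Set.Icc 0 α ∩ Set.Iic b = Set.Icc 0 b := by
    ext y
    simp only [Set.mem_inter_iff, Set.mem_Icc, Set.mem_Iic]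
    exact ⟨fun h => ⟨h.1.1, h.2⟩, fun h => ⟨⟨h.1, h.2.trans hb.2⟩, h.2⟩⟩
  have hsub := intervalIntegral.mul_integral_comp_mul_left (a := 0) (b := 1)
    (f := fun y => g (b, y)) b
  rw [mul_zero, mul_one, intervalIntegral.integral_of_le zero_le_one,
    intervalIntegral.integral_of_le hb.1, ← integral_Icc_eq_integral_Ioc,
    ← integral_Icc_eq_integral_Ioc] at hsub
  rw [integral_congr_ae hae, setIntegral_indicator measurableSet_Iic, hset, ← hsub,
    integral_const_mul]

/-- The polar-type formula of `double_integral_formula` for a globally continuous function. -/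
theorem Continuous.double_integral_formula {g : ℝ × ℝ → ℝ} (hg : Continuous g) (α : ℝ) :
    ∫ p in Set.Icc (0:ℝ) α ×ˢ Set.Icc (0:ℝ) α, g p
      = ∫ x in Set.Icc (0:ℝ) 1, ∫ b in Set.Icc (0:ℝ) α,
          b * (g (b, b * x) + g (b * x, b)) := by
  have hT : MeasurableSet {p : ℝ × ℝ | p.2 ≤ p.1} :=
    measurableSet_le measurable_snd measurable_fst
  have hT' : MeasurableSet {p : ℝ × ℝ | p.2 < p.1} :=
    measurableSet_lt measurable_snd measurable_fst
  have hint : IntegrableOn g (Set.Icc (0:ℝ) α ×ˢ Set.Icc (0:ℝ) α) :=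
    hg.continuousOn.integrableOn_compact (isCompact_Icc.prod isCompact_Icc)
  have hswap : Continuous fun p : ℝ × ℝ => g p.swap := hg.comp continuous_swap
  have h1 := setIntegral_indicator_below_diagonal hg (α := α) hT (fun p h => le_of_lt h)
    fun p h => h
  have h2 := setIntegral_indicator_below_diagonal hswap (α := α) hT' (fun p h => h)
    fun p h => le_of_lt h
  have h3 : ∫ p in Set.Icc (0:ℝ) α ×ˢ Set.Icc (0:ℝ) α,
        {p : ℝ × ℝ | p.2 < p.1}.indicator (fun p => g p.swap) p
      = ∫ p in Set.Icc (0:ℝ) α ×ˢ Set.Icc (0:ℝ) α, {p : ℝ × ℝ | p.2 ≤ p.1}ᶜ.indicator g p := by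
    rw [Measure.volume_eq_prod, ← setIntegral_prod_swap]
    refine integral_congr_ae (Filter.Eventually.of_forall fun p => ?_)
    simp [Set.indicator_apply]
  have hcont {k : ℝ × ℝ → ℝ} (hk : Continuous k) : IntegrableOn
      (fun x => ∫ b in Set.Icc (0:ℝ) α, b * k (b, b * x)) (Set.Icc 0 1) := by
    refine (continuous_parametric_integral_of_continuous ?_ isCompact_Icc).integrableOn_Icc
    fun_prop
  have hcont' {k : ℝ × ℝ → ℝ} (hk : Continuous k) (x : ℝ) : IntegrableOn
      (fun b => b * k (b, b * x)) (Set.Icc 0 α) := by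
    refine Continuous.integrableOn_Icc ?_
    fun_prop
  calc ∫ p in Set.Icc (0:ℝ) α ×ˢ Set.Icc (0:ℝ) α, g p
      = ∫ p in Set.Icc (0:ℝ) α ×ˢ Set.Icc (0:ℝ) α, ({p : ℝ × ℝ | p.2 ≤ p.1}.indicator g p
          + {p : ℝ × ℝ | p.2 ≤ p.1}ᶜ.indicator g p) := by
        simp only [Set.indicator_self_add_compl_apply]
    _ = (∫ x in Set.Icc (0:ℝ) 1, ∫ b in Set.Icc (0:ℝ) α, b * g (b, b * x))
          + ∫ x in Set.Icc (0:ℝ) 1, ∫ b in Set.Icc (0:ℝ) α, b * g (b, b * x).swap := by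
        rw [integral_add (hint.indicator hT) (hint.indicator hT.compl), h1, ← h3, h2]
    _ = _ := by
        rw [← integral_add (hcont hg) (hcont hswap)]
        refine integral_congr_ae (Filter.Eventually.of_forall fun x => ?_)
        simp only
        rw [← integral_add (hcont' hg x) (hcont' hswap x)]
        simp only [mul_add, Prod.swap_prod_mk]

/-- For `f : ℝ × ℝ → ℝ` continuous and bounded on `[0,B) × [0,B)` and
`0 ≤ α < B`, the double integral of `f` over `[0,α] × [0,α]` equals
`∫₀^1 (∫₀^α β·(f(β,βx) + f(βx,β)) dβ) dx`. -/
theorem double_integral_formula (B : ℝ) (hB : 0 < B) (f : ℝ × ℝ → ℝ)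
    (hcont : ContinuousOn f (Set.Ico 0 B ×ˢ Set.Ico 0 B))
    (hbdd : ∃ C : ℝ, ∀ p ∈ Set.Ico (0:ℝ) B ×ˢ Set.Ico (0:ℝ) B, |f p| ≤ C)
    (α : ℝ) (hα0 : 0 ≤ α) (hαB : α < B) :
    ∫ p in Set.Icc (0:ℝ) α ×ˢ Set.Icc (0:ℝ) α, f p
      = ∫ x in Set.Icc (0:ℝ) 1, ∫ β in Set.Icc (0:ℝ) α,
          β * (f (β, β * x) + f (β * x, β)) := by
  have hsub : Set.Icc 0 α ⊆ Set.Ico 0 B := fun x hx => ⟨hx.1, hx.2.trans_lt hαB⟩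
  let π : ℝ → ℝ := fun x => Set.projIcc 0 α hα0 x
  have hπ : Continuous π := continuous_subtype_val.comp continuous_projIcc
  have hπmem (x : ℝ) : π x ∈ Set.Ico 0 B := hsub (Set.projIcc 0 α hα0 x).2
  have hπeq {x : ℝ} (hx : x ∈ Set.Icc 0 α) : π x = x :=
    congrArg Subtype.val (Set.projIcc_of_mem hα0 hx)
  have hg : Continuous fun p : ℝ × ℝ => f (π p.1, π p.2) :=
    hcont.comp_continuous (by fun_prop) fun p => ⟨hπmem _, hπmem _⟩
  convert hg.double_integral_formula α using 1
  · refine setIntegral_congr_fun (measurableSet_Icc.prod measurableSet_Icc) fun p hp => ?_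
    simp only [hπeq hp.1, hπeq hp.2]
  · refine setIntegral_congr_fun measurableSet_Icc fun x hx => ?_
    refine setIntegral_congr_fun measurableSet_Icc fun b hb => ?_
    have hbx : b * x ∈ Set.Icc 0 α :=
      ⟨mul_nonneg hb.1 hx.1, (mul_le_of_le_one_right hb.1 hx.2).trans hb.2⟩
    simp only [hπeq hb, hπeq hbx]
end

section
/- Let n ≥ 2 be a natural number, B > 0, and let f : (Fin n → ℝ) → ℝ be continuous and bounded on the cube [0,B)^n. Then for every α with 0 ≤ α < B, ∫_{[0,α]^n} f(x₁,…,xₙ) dx₁⋯dxₙ = ∫_{[0,1]^n} ( ∫₀^α β^{n-1} · ( Σ_{p=1}^{n} f(βx₁, …, βx_{p-1}, β, βx_{p+1}, …, βxₙ) ) dβ ) dx₁⋯dxₙ, where in the p-th summand the p-th coordinate is β and every other coordinate x_q is replaced by βx_q. -/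
open MeasureTheory

/-- The part of the cube `[0,α]^(m+1)` on which the `p`-th coordinate is maximal. -/
def maxCoordCell {m : ℕ} (α : ℝ) (p : Fin (m + 1)) : Set (Fin (m + 1) → ℝ) :=
  {x | x p ∈ Set.Icc 0 α ∧ ∀ i, x i ∈ Set.Icc 0 (x p)}

theorem isClosed_maxCoordCell {m : ℕ} (α : ℝ) (p : Fin (m + 1)) :
    IsClosed (maxCoordCell α p) := by
  simp only [maxCoordCell, Set.mem_Icc, Set.ofPred_and, Set.ofPred_forall]
  refine ((isClosed_le ?_ ?_).inter (isClosed_le ?_ ?_)).inter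
    (isClosed_iInter fun i => (isClosed_le ?_ ?_).inter (isClosed_le ?_ ?_)) <;> fun_prop

theorem iUnion_maxCoordCell {m : ℕ} (α : ℝ) :
    ⋃ p : Fin (m + 1), maxCoordCell α p = Set.univ.pi fun _ => Set.Icc (0 : ℝ) α := by
  ext x
  simp only [maxCoordCell, Set.mem_iUnion, Set.mem_ofPred_eq, Set.mem_univ_pi, Set.mem_Icc]
  constructor
  · rintro ⟨p, hp, h⟩ i
    exact ⟨(h i).1, (h i).2.trans hp.2⟩
  · intro h
    obtain ⟨p, hp⟩ := Finite.exists_max x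
    exact ⟨p, h p, fun i => ⟨(h i).1, hp i⟩⟩

theorem volume_setOf_coord_eq {ι : Type*} [Fintype ι] {p q : ι} (hpq : p ≠ q) :
    volume {x : ι → ℝ | x p = x q} = 0 := by
  classical
  let L : (ι → ℝ) →ₗ[ℝ] ℝ :=
    LinearMap.proj (R := ℝ) (φ := fun _ => ℝ) p - LinearMap.proj (R := ℝ) (φ := fun _ => ℝ) q
  have hL : {x : ι → ℝ | x p = x q} = (LinearMap.ker L : Set (ι → ℝ)) := by
    ext x
    simp [L, sub_eq_zero]
  rw [hL]
  refine Measure.addHaar_submodule _ _ fun h => ?_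
  have : Pi.single p (1 : ℝ) ∈ LinearMap.ker L := h ▸ Submodule.mem_top
  simp [L, hpq.symm] at this

theorem pairwise_aedisjoint_maxCoordCell {m : ℕ} (α : ℝ) :
    Pairwise (Function.onFun (AEDisjoint volume) (maxCoordCell (m := m) α)) := by
  intro p q hpq
  refine measure_mono_null ?_ (volume_setOf_coord_eq hpq)
  rintro x ⟨hp, hq⟩
  exact le_antisymm (hq.2 p).2 (hp.2 q).2

open scoped Pointwise in
theorem setIntegral_cube_scale {m : ℕ} {β : ℝ} (hβ : 0 < β) (h : (Fin m → ℝ) → ℝ) :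
    ∫ y in Set.univ.pi (fun _ : Fin m => Set.Icc (0 : ℝ) β), h y
      = β ^ m * ∫ y in Set.univ.pi (fun _ : Fin m => Set.Icc (0 : ℝ) 1), h (β • y) := by
  have hs : β • Set.univ.pi (fun _ : Fin m => Set.Icc (0 : ℝ) 1)
      = Set.univ.pi (fun _ : Fin m => Set.Icc (0 : ℝ) β) := by
    rw [smul_univ_pi]
    congr 1
    ext1 i
    simp [LinearOrderedField.smul_Icc hβ]
  rw [Measure.setIntegral_comp_smul_of_pos _ _ _ hβ, hs, Module.finrank_fin_fun, smul_eq_mul,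
    mul_inv_cancel_left₀ (pow_pos hβ m).ne']

theorem setIntegral_maxCoordCell {m : ℕ} (α : ℝ) (p : Fin (m + 1))
    {g : (Fin (m + 1) → ℝ) → ℝ} (hg : Continuous g) :
    ∫ x in maxCoordCell α p, g x
      = ∫ β in Set.Icc (0 : ℝ) α, β ^ m *
          ∫ y in Set.univ.pi (fun _ : Fin m => Set.Icc (0 : ℝ) 1), g (p.insertNth β (β • y)) := by
  have hmp := (volume_preserving_piFinSuccAbove (fun _ : Fin (m + 1) => ℝ) p).symm
  rw [← hmp.setIntegral_preimage_emb (MeasurableEquiv.measurableEmbedding _)]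
  set T := (MeasurableEquiv.piFinSuccAbove (fun _ : Fin (m + 1) => ℝ) p).symm ⁻¹'
    maxCoordCell α p
  have hmem (β : ℝ) (y : Fin m → ℝ) : (β, y) ∈ T ↔
      β ∈ Set.Icc 0 α ∧ y ∈ Set.univ.pi (fun _ : Fin m => Set.Icc (0 : ℝ) β) := by
    change p.insertNth (α := fun _ => ℝ) β y ∈ maxCoordCell α p ↔ _
    simp only [maxCoordCell, Set.mem_ofPred_eq, Fin.forall_iff_succAbove p,
      Fin.insertNth_apply_same, Fin.insertNth_apply_succAbove, Set.mem_Icc, Set.mem_univ_pi]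
    tauto
  have hcont : Continuous fun z : ℝ × (Fin m → ℝ) => p.insertNth (α := fun _ => ℝ) z.1 z.2 :=
    Continuous.finInsertNth (A := fun _ => ℝ) p continuous_fst continuous_snd
  have hclosed : IsClosed T := (isClosed_maxCoordCell α p).preimage hcont
  have hcompact : IsCompact T := by
    refine (isCompact_Icc.prod (isCompact_univ_pi fun _ : Fin m =>
      isCompact_Icc (a := (0 : ℝ)) (b := α))).of_isClosed_subset (s := Set.Icc 0 α ×ˢ _) hclosed ?_
    rintro ⟨β, y⟩ hz
    obtain ⟨h1, h2⟩ := (hmem β y).1 hz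
    exact ⟨h1, fun i hi => ⟨(h2 i hi).1, (h2 i hi).2.trans h1.2⟩⟩
  have hint : IntegrableOn (fun z : ℝ × (Fin m → ℝ) => g (p.insertNth z.1 z.2)) T :=
    (hg.comp hcont).continuousOn.integrableOn_compact hcompact
  change ∫ z in T, g (p.insertNth z.1 z.2) = _
  rw [← integral_indicator hclosed.measurableSet, Measure.volume_eq_prod,
    integral_prod _ ((integrable_indicator_iff hclosed.measurableSet).2 hint),
    ← integral_indicator measurableSet_Icc]
  refine integral_congr_ae ?_
  filter_upwards [Measure.ae_ne volume (0 : ℝ)] with β hβ0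
  by_cases hβ : β ∈ Set.Icc 0 α
  · rw [Set.indicator_of_mem hβ,
      ← setIntegral_cube_scale (lt_of_le_of_ne hβ.1 hβ0.symm) fun y => g (p.insertNth β y),
      ← integral_indicator (MeasurableSet.univ_pi fun _ => measurableSet_Icc)]
    congr 1 with y
    have hy := (hmem β y).trans (and_iff_right hβ)
    by_cases h : (β, y) ∈ T
    · rw [Set.indicator_of_mem h, Set.indicator_of_mem (hy.1 h)]
    · rw [Set.indicator_of_notMem h, Set.indicator_of_notMem (h ∘ hy.2)]
  · simp [Set.indicator, hmem, hβ]

theorem setIntegral_cube_comp_removeNth {m : ℕ} (p : Fin (m + 1)) (h : (Fin m → ℝ) → ℝ) :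
    ∫ x in Set.univ.pi (fun _ : Fin (m + 1) => Set.Icc (0 : ℝ) 1), h (p.removeNth x)
      = ∫ y in Set.univ.pi (fun _ : Fin m => Set.Icc (0 : ℝ) 1), h y := by
  have hmp := volume_preserving_piFinSuccAbove (fun _ : Fin (m + 1) => ℝ) p
  have hpre : MeasurableEquiv.piFinSuccAbove (fun _ : Fin (m + 1) => ℝ) p ⁻¹'
      (Set.Icc (0 : ℝ) 1 ×ˢ Set.univ.pi (fun _ : Fin m => Set.Icc (0 : ℝ) 1))
      = Set.univ.pi (fun _ : Fin (m + 1) => Set.Icc (0 : ℝ) 1) := by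
    ext x
    rw [Set.mem_univ_pi, Fin.forall_iff_succAbove p, ← Set.mem_univ_pi (t := fun _ => Set.Icc _ _)]
    rfl
  have hset := hmp.setIntegral_preimage_emb (MeasurableEquiv.measurableEmbedding _)
    (fun z => h z.2) (Set.Icc (0 : ℝ) 1 ×ˢ Set.univ.pi (fun _ : Fin m => Set.Icc (0 : ℝ) 1))
  rw [hpre] at hset
  refine hset.trans ?_
  rw [Measure.volume_eq_prod, ← Measure.prod_restrict, integral_fun_snd]
  simp

theorem update_smul_eq_insertNth {m : ℕ} (p : Fin (m + 1)) (β : ℝ) (x : Fin (m + 1) → ℝ) :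
    Function.update (β • x) p β = p.insertNth β (β • p.removeNth x) := by
  rw [← Fin.insertNth_removeNth]
  rfl

theorem setIntegral_cube_eq_of_continuous {m : ℕ} (α : ℝ)
    {g : (Fin (m + 1) → ℝ) → ℝ} (hg : Continuous g) :
    ∫ x in Set.univ.pi (fun _ : Fin (m + 1) => Set.Icc (0 : ℝ) α), g x
      = ∫ x in Set.univ.pi (fun _ : Fin (m + 1) => Set.Icc (0 : ℝ) 1),
          ∫ β in Set.Icc (0 : ℝ) α,
            β ^ m * ∑ p : Fin (m + 1), g (Function.update (β • x) p β) := by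
  have hcube (c : ℝ) (k : ℕ) : IsCompact (Set.univ.pi fun _ : Fin k => Set.Icc (0 : ℝ) c) :=
    isCompact_univ_pi fun _ => isCompact_Icc
  have hupd (p : Fin (m + 1)) :
      Continuous fun z : (Fin (m + 1) → ℝ) × ℝ => g (Function.update (z.2 • z.1) p z.2) :=
    hg.comp ((continuous_snd.smul continuous_fst).update p continuous_snd)
  have hint (β : ℝ) (p : Fin (m + 1)) :
      IntegrableOn (fun x : Fin (m + 1) → ℝ => g (Function.update (β • x) p β))
        (Set.univ.pi fun _ => Set.Icc (0 : ℝ) 1) :=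
    ((hupd p).comp (continuous_id.prodMk continuous_const)).continuousOn.integrableOn_compact
      (hcube 1 _)
  have hcell (p : Fin (m + 1)) : ∫ x in maxCoordCell α p, g x = ∫ β in Set.Icc (0 : ℝ) α, β ^ m *
      ∫ x in Set.univ.pi (fun _ : Fin (m + 1) => Set.Icc (0 : ℝ) 1),
        g (Function.update (β • x) p β) := by
    rw [setIntegral_maxCoordCell α p hg]
    congr 1 with β
    simp_rw [update_smul_eq_insertNth]
    rw [setIntegral_cube_comp_removeNth p fun y => g (p.insertNth β (β • y))]
  have hcellInt (p : Fin (m + 1)) : IntegrableOn (fun β : ℝ => β ^ m *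
      ∫ x in Set.univ.pi (fun _ : Fin (m + 1) => Set.Icc (0 : ℝ) 1),
        g (Function.update (β • x) p β)) (Set.Icc 0 α) := by
    refine Continuous.integrableOn_Icc ((continuous_pow m).mul ?_)
    exact continuous_parametric_integral_of_continuous
      (f := fun β x => g (Function.update (β • x) p β)) ((hupd p).comp continuous_swap) (hcube 1 _)
  rw [integral_integral_swap]
  · rw [← iUnion_maxCoordCell, integral_iUnion_ae
      (fun p => (isClosed_maxCoordCell α p).measurableSet.nullMeasurableSet)
      (pairwise_aedisjoint_maxCoordCell α)
      (by rw [iUnion_maxCoordCell]; exact hg.continuousOn.integrableOn_compact (hcube α _)),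
      tsum_fintype]
    simp_rw [hcell]
    rw [← integral_finsetSum _ fun p _ => hcellInt p]
    congr 1 with β
    rw [integral_const_mul, integral_finsetSum _ fun p _ => hint β p, Finset.mul_sum]
  · rw [Measure.prod_restrict]
    refine Continuous.continuousOn ?_ |>.integrableOn_compact ((hcube 1 _).prod isCompact_Icc)
    exact (continuous_snd.pow m).mul (continuous_finsetSum _ fun p _ => hupd p)

/-- For `n ≥ 2`, `f : (Fin n → ℝ) → ℝ` continuous and bounded on `[0,B)^n`,
and `0 ≤ α < B`, the integral of `f` over the cube `[0,α]^n` equals the integral over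
`[0,1]^n` of `∫₀^α β^(n-1) · Σ_{p} f(Function.update (β • x) p β) dβ`. -/
theorem multiple_integral_formula (n : ℕ) (hn : 2 ≤ n) (B : ℝ) (hB : 0 < B)
    (f : (Fin n → ℝ) → ℝ)
    (hcont : ContinuousOn f (Set.univ.pi fun _ => Set.Ico (0:ℝ) B))
    (hbdd : ∃ C : ℝ, ∀ x ∈ Set.univ.pi fun _ => Set.Ico (0:ℝ) B, |f x| ≤ C)
    (α : ℝ) (hα0 : 0 ≤ α) (hαB : α < B) :
    ∫ x in Set.univ.pi (fun _ : Fin n => Set.Icc (0:ℝ) α), f x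
      = ∫ x in Set.univ.pi (fun _ : Fin n => Set.Icc (0:ℝ) 1),
          ∫ β in Set.Icc (0:ℝ) α,
            β ^ (n - 1) * ∑ p : Fin n, f (Function.update (β • x) p β) := by
  obtain ⟨m, rfl⟩ : ∃ m, n = m + 1 := ⟨n - 1, by lia⟩
  have hcubeMeas (c : ℝ) : MeasurableSet (Set.univ.pi fun _ : Fin (m + 1) => Set.Icc (0 : ℝ) c) :=
    MeasurableSet.univ_pi fun _ => measurableSet_Icc
  let clamp : (Fin (m + 1) → ℝ) → Fin (m + 1) → ℝ := fun x i => max 0 (min α (x i))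
  have hclamp : ∀ x ∈ Set.univ.pi (fun _ : Fin (m + 1) => Set.Icc (0 : ℝ) α), clamp x = x := by
    intro x hx
    ext i
    obtain ⟨h0, h1⟩ := hx i trivial
    simp [clamp, h0, h1]
  have hg : Continuous (f ∘ clamp) := by
    refine hcont.comp_continuous (by fun_prop) fun x i _ => ⟨le_max_left _ _, ?_⟩
    exact max_lt hB ((min_le_left _ _).trans_lt hαB)
  rw [setIntegral_congr_fun (hcubeMeas α) fun x hx => (congrArg f (hclamp x hx)).symm]
  refine (setIntegral_cube_eq_of_continuous α hg).trans ?_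
  refine setIntegral_congr_fun (hcubeMeas 1) fun x hx => ?_
  refine setIntegral_congr_fun measurableSet_Icc fun β hβ => ?_
  simp only [Nat.add_sub_cancel, Function.comp_apply]
  congr 1
  refine Finset.sum_congr rfl fun p _ => congrArg f (hclamp _ fun i _ => ?_)
  rcases eq_or_ne i p with rfl | hi
  · simpa using hβ
  · obtain ⟨h0, h1⟩ := hx i trivial
    simpa [hi] using And.intro (mul_nonneg hβ.1 h0) ((mul_le_of_le_one_right hβ.1 h1).trans hβ.2)
end

section
/- For all real numbers u > 0 and v > 0, ∫₀^u ∫₀^v 1/(1 + t³ + s³) dt ds + ∫₀^{1/u} ∫₀^{v/u} 1/(1 + t³ + s³) dt ds + ∫₀^{1/v} ∫₀^{u/v} 1/(1 + t³ + s³) dt ds = 3 · ((1/3) · Γ(1/3))³, where Γ is the Gamma function. -/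
open MeasureTheory

open Filter Topology

lemma integrableOn_and_integral_sq_mul_exp_neg_cube_mul {c : ℝ} (hc : 0 < c) :
    IntegrableOn (fun z : ℝ => 3 * z ^ 2 * Real.exp (-(z ^ 3 * c))) (Set.Ioi 0) ∧
      ∫ z in Set.Ioi (0:ℝ), 3 * z ^ 2 * Real.exp (-(z ^ 3 * c)) = 1 / c := by
  have hd : ∀ z : ℝ, HasDerivAt (fun z : ℝ => -(Real.exp (-(z ^ 3 * c)) / c))
      (3 * z ^ 2 * Real.exp (-(z ^ 3 * c))) z := by
    intro z
    have h := ((((hasDerivAt_pow 3 z).mul_const c).neg.exp).div_const c).neg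
    refine h.congr_deriv ?_
    simp only [Pi.neg_apply]
    field_simp
    push_cast
    ring
  have ht : Tendsto (fun z : ℝ => -(Real.exp (-(z ^ 3 * c)) / c)) atTop (𝓝 0) := by
    have h1 : Tendsto (fun z : ℝ => z ^ 3 * c) atTop atTop :=
      (tendsto_pow_atTop (by norm_num)).atTop_mul_const hc
    have h2 := ((Real.tendsto_exp_neg_atTop_nhds_zero.comp h1).div_const c).neg
    simpa using h2
  have hi := integrableOn_Ioi_deriv_of_nonneg' (a := 0) (fun z _ => hd z)
    (fun z _ => by positivity) ht
  refine ⟨hi, ?_⟩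
  rw [integral_Ioi_of_hasDerivAt_of_tendsto' (fun z _ => hd z) hi ht]
  simp

/-- The primitive of `t ↦ exp (-t³)` vanishing at `0`. -/
noncomputable def expNegCubePrimitive (x : ℝ) : ℝ := ∫ t in (0:ℝ)..x, Real.exp (-t ^ 3)

lemma hasDerivAt_expNegCubePrimitive (x : ℝ) :
    HasDerivAt expNegCubePrimitive (Real.exp (-x ^ 3)) x := by
  have hc : Continuous fun t : ℝ => Real.exp (-t ^ 3) := by fun_prop
  exact hc.integral_hasStrictDerivAt 0 x |>.hasDerivAt

lemma tendsto_expNegCubePrimitive :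
    Tendsto expNegCubePrimitive atTop (𝓝 ((1 / 3) * Real.Gamma (1 / 3))) := by
  have hI : ∫ t in Set.Ioi (0:ℝ), Real.exp (-t ^ 3) = (1 / 3) * Real.Gamma (1 / 3) := by
    have h := integral_exp_neg_rpow (p := 3) (by norm_num)
    rw [Real.Gamma_add_one (by norm_num)] at h
    rw [← h]
    norm_cast
  have hpos : (0:ℝ) < (1 / 3) * Real.Gamma (1 / 3) :=
    mul_pos (by norm_num) (Real.Gamma_pos_of_pos (by norm_num))
  rw [← hI] at hpos ⊢
  exact intervalIntegral_tendsto_integral_Ioi 0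
    (Integrable.of_integral_ne_zero hpos.ne') tendsto_id

lemma mul_setIntegral_exp_neg_mul_cube {a : ℝ} (ha : 0 ≤ a) (z : ℝ) :
    z * ∫ t in Set.Icc (0:ℝ) a, Real.exp (-(z * t) ^ 3) = expNegCubePrimitive (a * z) := by
  rw [integral_Icc_eq_integral_Ioc, ← intervalIntegral.integral_of_le ha,
    intervalIntegral.mul_integral_comp_mul_left (f := fun t => Real.exp (-t ^ 3)),
    expNegCubePrimitive, mul_zero, mul_comm z a]

lemma integrableOn_and_setIntegral_one_div_one_add_cubes {a b : ℝ} (ha : 0 ≤ a) (hb : 0 ≤ b) :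
    IntegrableOn (fun z => 3 * (expNegCubePrimitive (a * z) * expNegCubePrimitive (b * z) *
        Real.exp (-z ^ 3))) (Set.Ioi 0) ∧
      ∫ p in Set.Icc (0:ℝ) a ×ˢ Set.Icc (0:ℝ) b, 1 / (1 + p.1 ^ 3 + p.2 ^ 3) =
        ∫ z in Set.Ioi (0:ℝ), 3 * (expNegCubePrimitive (a * z) * expNegCubePrimitive (b * z) *
          Real.exp (-z ^ 3)) := by
  set R := Set.Icc (0:ℝ) a ×ˢ Set.Icc (0:ℝ) b with hR
  have hRm : MeasurableSet R := measurableSet_Icc.prod measurableSet_Icc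
  have hpos : ∀ p ∈ R, 0 < 1 + p.1 ^ 3 + p.2 ^ 3 := by
    rintro p ⟨h1, h2⟩
    have := h1.1
    have := h2.1
    positivity
  let f : (ℝ × ℝ) × ℝ → ℝ := fun q =>
    3 * q.2 ^ 2 * Real.exp (-(q.2 ^ 3 * (1 + q.1.1 ^ 3 + q.1.2 ^ 3)))
  have hfc : Continuous f := by fun_prop
  have hinner : ∀ p ∈ R, ∫ z in Set.Ioi (0:ℝ), f (p, z) = 1 / (1 + p.1 ^ 3 + p.2 ^ 3) :=
    fun p hp => (integrableOn_and_integral_sq_mul_exp_neg_cube_mul (hpos p hp)).2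
  have hrat : IntegrableOn (fun p : ℝ × ℝ => 1 / (1 + p.1 ^ 3 + p.2 ^ 3)) R := by
    apply ContinuousOn.integrableOn_compact (isCompact_Icc.prod isCompact_Icc)
    exact ContinuousOn.div (by fun_prop) (by fun_prop) fun p hp => (hpos p hp).ne'
  have hfi : Integrable f ((volume.restrict R).prod (volume.restrict (Set.Ioi (0:ℝ)))) := by
    rw [integrable_prod_iff hfc.aestronglyMeasurable]
    constructor
    · filter_upwards [ae_restrict_mem hRm] with p hp
      exact (integrableOn_and_integral_sq_mul_exp_neg_cube_mul (hpos p hp)).1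
    · refine hrat.congr ?_
      filter_upwards [ae_restrict_mem hRm] with p hp
      rw [← hinner p hp]
      refine integral_congr_ae (Eventually.of_forall fun z => ?_)
      exact (Real.norm_of_nonneg (by positivity)).symm
  have houter : ∀ z : ℝ, ∫ p in R, f (p, z) =
      3 * (expNegCubePrimitive (a * z) * expNegCubePrimitive (b * z) * Real.exp (-z ^ 3)) := by
    intro z
    have hsplit : ∀ p : ℝ × ℝ, f (p, z) = 3 * z ^ 2 * Real.exp (-z ^ 3) *
        (Real.exp (-(z * p.1) ^ 3) * Real.exp (-(z * p.2) ^ 3)) := by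
      intro p
      simp only [f]
      rw [← Real.exp_add, mul_assoc _ (Real.exp _), ← Real.exp_add]
      ring_nf
    simp_rw [hsplit]
    rw [integral_const_mul, hR, Measure.volume_eq_prod,
      setIntegral_prod_mul (fun t => Real.exp (-(z * t) ^ 3)) (fun t => Real.exp (-(z * t) ^ 3)),
      ← mul_setIntegral_exp_neg_mul_cube ha, ← mul_setIntegral_exp_neg_mul_cube hb]
    ring
  have hswap := integral_integral_swap (f := fun p z => f (p, z)) hfi
  refine ⟨hfi.integral_prod_right.congr (Eventually.of_forall houter), ?_⟩
  rw [← setIntegral_congr_fun hRm hinner, hswap]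
  simp_rw [houter]

lemma integrableOn_and_setIntegral_one_div_one_add_cubes_div {a b c : ℝ} (ha : 0 ≤ a)
    (hb : 0 ≤ b) (hc : 0 < c) :
    IntegrableOn (fun z => 3 * (expNegCubePrimitive (a * z) * expNegCubePrimitive (b * z) *
        (Real.exp (-(c * z) ^ 3) * c))) (Set.Ioi 0) ∧
      ∫ p in Set.Icc (0:ℝ) (a / c) ×ˢ Set.Icc (0:ℝ) (b / c), 1 / (1 + p.1 ^ 3 + p.2 ^ 3) =
        ∫ z in Set.Ioi (0:ℝ), 3 * (expNegCubePrimitive (a * z) * expNegCubePrimitive (b * z) *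
          (Real.exp (-(c * z) ^ 3) * c)) := by
  obtain ⟨hi, he⟩ := integrableOn_and_setIntegral_one_div_one_add_cubes
    (div_nonneg ha hc.le) (div_nonneg hb hc.le)
  set g : ℝ → ℝ := fun z => 3 * (expNegCubePrimitive (a / c * z) *
    expNegCubePrimitive (b / c * z) * Real.exp (-z ^ 3)) with hg
  have hfun : (fun z => 3 * (expNegCubePrimitive (a * z) * expNegCubePrimitive (b * z) *
      (Real.exp (-(c * z) ^ 3) * c))) = fun z => c * g (c * z) := by
    funext z
    simp only [hg]
    rw [show a / c * (c * z) = a * z by field_simp, show b / c * (c * z) = b * z by field_simp]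
    ring
  rw [hfun]
  constructor
  · have h := (integrableOn_Ioi_comp_mul_left_iff g 0 hc).2 (by simpa using hi)
    exact h.const_mul c
  · rw [he, integral_const_mul c, integral_comp_mul_left_Ioi g 0 hc, mul_zero, smul_eq_mul,
      mul_inv_cancel_left₀ hc.ne']

/-- For `u, v > 0`,
`∫₀^u∫₀^v 1/(1+t³+s³) + ∫₀^{1/u}∫₀^{v/u} 1/(1+t³+s³) + ∫₀^{1/v}∫₀^{u/v} 1/(1+t³+s³)
  = 3 · ((1/3)·Γ(1/3))³`. -/
theorem arctan3_functional_equation (u v : ℝ) (hu : 0 < u) (hv : 0 < v) :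
    (∫ p in Set.Icc (0:ℝ) u ×ˢ Set.Icc (0:ℝ) v, 1 / (1 + p.1 ^ 3 + p.2 ^ 3))
      + (∫ p in Set.Icc (0:ℝ) (1 / u) ×ˢ Set.Icc (0:ℝ) (v / u),
          1 / (1 + p.1 ^ 3 + p.2 ^ 3))
      + (∫ p in Set.Icc (0:ℝ) (1 / v) ×ˢ Set.Icc (0:ℝ) (u / v),
          1 / (1 + p.1 ^ 3 + p.2 ^ 3))
      = 3 * ((1 / 3) * Real.Gamma (1 / 3)) ^ 3 := by
  obtain ⟨i₁, e₁⟩ := integrableOn_and_setIntegral_one_div_one_add_cubes hu.le hv.le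
  obtain ⟨i₂, e₂⟩ :=
    integrableOn_and_setIntegral_one_div_one_add_cubes_div zero_le_one hv.le hu
  obtain ⟨i₃, e₃⟩ :=
    integrableOn_and_setIntegral_one_div_one_add_cubes_div zero_le_one hu.le hv
  have hscale : ∀ c z : ℝ, HasDerivAt (fun z => expNegCubePrimitive (c * z))
      (Real.exp (-(c * z) ^ 3) * c) z := fun c z =>
    (hasDerivAt_expNegCubePrimitive (c * z)).comp z (hasDerivAt_const_mul c)
  have hd := fun z : ℝ => (((hasDerivAt_expNegCubePrimitive z).mul (hscale u z)).mul
    (hscale v z)).const_mul 3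
  have hlim : ∀ c : ℝ, 0 < c → Tendsto (fun z => expNegCubePrimitive (c * z)) atTop
      (𝓝 ((1 / 3) * Real.Gamma (1 / 3))) := fun c hc =>
    tendsto_expNegCubePrimitive.comp (tendsto_id.const_mul_atTop hc)
  have ht := ((tendsto_expNegCubePrimitive.mul (hlim u hu)).mul (hlim v hv)).const_mul 3
  rw [e₁, e₂, e₃, ← integral_add' i₁ i₂, ← integral_add' (i₁.add i₂) i₃]
  have hi := (i₁.add i₂).add i₃
  trans 3 * ((1 / 3) * Real.Gamma (1 / 3) * ((1 / 3) * Real.Gamma (1 / 3)) *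
    ((1 / 3) * Real.Gamma (1 / 3))) - 3 * (expNegCubePrimitive 0 * expNegCubePrimitive (u * 0) *
      expNegCubePrimitive (v * 0))
  · refine integral_Ioi_of_hasDerivAt_of_tendsto' (fun z _ => (hd z).congr_deriv ?_) hi ht
    simp only [Pi.add_apply, Pi.mul_apply, one_mul]
    ring
  · simp only [expNegCubePrimitive, mul_zero, intervalIntegral.integral_same, sub_zero]
    ring
end

section
/- Let n ≥ 2 be a natural number. For positive reals u₁, …, u_{n-1}, define arctanₙ(u₁,…,u_{n-1}) = ∫₀^{u₁} ⋯ ∫₀^{u_{n-1}} 1/(1 + x₁ⁿ + ⋯ + x_{n-1}ⁿ) dx₁⋯dx_{n-1}. Then arctanₙ(u₁, …, u_{n-1}) + Σ_{p=1}^{n-1} arctanₙ(u₁/u_p, …, u_{p-1}/u_p, 1/u_p, u_{p+1}/u_p, …, u_{n-1}/u_p) = n · ((1/n) · Γ(1/n))ⁿ, where in the p-th summand the p-th argument of arctanₙ is 1/u_p and the q-th argument (q ≠ p) is u_q/u_p. -/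
open MeasureTheory

/-- The `n`-th order arctan: the Lebesgue integral of
`x ↦ 1/(1 + x₁ⁿ + ⋯ + x_{n-1}ⁿ)` over the box `[0,u₁] × ⋯ × [0,u_{n-1}]`. -/
noncomputable def arctanN (n : ℕ) (u : Fin (n - 1) → ℝ) : ℝ :=
  ∫ x in Set.univ.pi (fun i => Set.Icc (0:ℝ) (u i)),
    1 / (1 + ∑ i, x i ^ n)

open Set Filter Topology

theorem integrableOn_pow_mul_exp_neg_pow {n : ℕ} (hn : n ≠ 0) (k : ℕ) :
    IntegrableOn (fun t : ℝ => t ^ k * Real.exp (-t ^ n)) (Ioi 0) := by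
  have hk : (-1 : ℝ) < k := by linarith [k.cast_nonneg (α := ℝ)]
  simpa using integrableOn_rpow_mul_exp_neg_rpow hk (Nat.cast_pos.2 hn.bot_lt : (0 : ℝ) < n)

theorem integrableOn_exp_neg_pow {n : ℕ} (hn : n ≠ 0) :
    IntegrableOn (fun t : ℝ => Real.exp (-t ^ n)) (Ioi 0) := by
  simpa using integrableOn_pow_mul_exp_neg_pow hn 0

theorem integral_Ioi_exp_neg_pow {n : ℕ} (hn : n ≠ 0) :
    ∫ t in Ioi (0 : ℝ), Real.exp (-t ^ n) = 1 / n * Real.Gamma (1 / n) := by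
  have hn' : (0 : ℝ) < n := Nat.cast_pos.2 hn.bot_lt
  rw [← Real.Gamma_add_one (one_div_pos.2 hn').ne', ← integral_exp_neg_rpow hn']
  simp

theorem integral_Ioi_pow_mul_exp_neg_pow_mul {n : ℕ} (hn : n ≠ 0) {c : ℝ} (hc : 0 < c) :
    ∫ t in Ioi (0 : ℝ), t ^ (n - 1) * Real.exp (-(t ^ n * c)) = 1 / n * (1 / c) := by
  have hn' : (0 : ℝ) < n := Nat.cast_pos.2 hn.bot_lt
  have h := integral_rpow_mul_exp_neg_mul_rpow hn'
    (by linarith [(n - 1).cast_nonneg (α := ℝ)] : (-1 : ℝ) < (n - 1 : ℕ)) hc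
  have hcast : ((n - 1 : ℕ) : ℝ) + 1 = n := by exact_mod_cast Nat.sub_add_cancel hn.bot_lt
  rw [hcast, neg_div, div_self hn'.ne', Real.rpow_neg_one, Real.Gamma_one] at h
  simp only [Real.rpow_natCast] at h
  simp only [mul_comm _ c, ← neg_mul, h]
  ring

/-- The primitive `s ↦ ∫₀ˢ exp (-yⁿ) dy`. -/
noncomputable def expNegPowPrimitive (n : ℕ) (s : ℝ) : ℝ :=
  ∫ y in (0 : ℝ)..s, Real.exp (-y ^ n)

theorem hasDerivAt_expNegPowPrimitive (n : ℕ) (s : ℝ) :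
    HasDerivAt (expNegPowPrimitive n) (Real.exp (-s ^ n)) s :=
  (by fun_prop : Continuous fun y : ℝ => Real.exp (-y ^ n)).integral_hasStrictDerivAt 0 s
    |>.hasDerivAt

@[fun_prop]
theorem continuous_expNegPowPrimitive (n : ℕ) : Continuous (expNegPowPrimitive n) :=
  continuous_iff_continuousAt.2 fun s => (hasDerivAt_expNegPowPrimitive n s).continuousAt

theorem expNegPowPrimitive_nonneg (n : ℕ) {s : ℝ} (hs : 0 ≤ s) : 0 ≤ expNegPowPrimitive n s :=
  intervalIntegral.integral_nonneg hs fun _ _ => (Real.exp_pos _).le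

theorem tendsto_expNegPowPrimitive {n : ℕ} (hn : n ≠ 0) :
    Tendsto (expNegPowPrimitive n) atTop (𝓝 (1 / n * Real.Gamma (1 / n))) := by
  rw [← integral_Ioi_exp_neg_pow hn]
  exact intervalIntegral_tendsto_integral_Ioi 0 (integrableOn_exp_neg_pow hn) tendsto_id

theorem expNegPowPrimitive_le {n : ℕ} (hn : n ≠ 0) {s : ℝ} :
    expNegPowPrimitive n s ≤ 1 / n * Real.Gamma (1 / n) :=
  (monotone_of_deriv_nonneg (fun s => (hasDerivAt_expNegPowPrimitive n s).differentiableAt)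
    fun s => (hasDerivAt_expNegPowPrimitive n s).deriv ▸ (Real.exp_pos _).le).ge_of_tendsto
    (tendsto_expNegPowPrimitive hn) s

theorem mul_integral_Icc_exp_neg_mul_pow (n : ℕ) {t u : ℝ} (hu : 0 ≤ u) :
    t * ∫ x in Icc 0 u, Real.exp (-(t * x) ^ n) = expNegPowPrimitive n (t * u) := by
  rw [integral_Icc_eq_integral_Ioc, ← intervalIntegral.integral_of_le hu]
  simpa [expNegPowPrimitive] using intervalIntegral.mul_integral_comp_mul_left (a := 0) (b := u)
    (f := fun y : ℝ => Real.exp (-y ^ n)) t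

theorem integrableOn_exp_neg_pow_mul_prod {ι : Type*} {n : ℕ} (hn : n ≠ 0) (s : Finset ι)
    {u : ι → ℝ} (hu : ∀ i, 0 ≤ u i) :
    IntegrableOn (fun t => Real.exp (-t ^ n) * ∏ i ∈ s, expNegPowPrimitive n (t * u i))
      (Ioi 0) := by
  refine (integrableOn_exp_neg_pow hn).mul_bdd
    (c := ∏ _i ∈ s, (1 / n * Real.Gamma (1 / n)))
    (by fun_prop : Continuous _).aestronglyMeasurable ?_
  filter_upwards [ae_restrict_mem measurableSet_Ioi] with t ht
  have h0 (i : ι) : 0 ≤ expNegPowPrimitive n (t * u i) :=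
    expNegPowPrimitive_nonneg n (mul_nonneg (mem_Ioi.1 ht).le (hu i))
  rw [Real.norm_of_nonneg (Finset.prod_nonneg fun i _ => h0 i)]
  exact Finset.prod_le_prod (fun i _ => h0 i) fun i _ => expNegPowPrimitive_le hn

theorem arctanN_eq_integral {n : ℕ} (hn : n ≠ 0) {u : Fin (n - 1) → ℝ} (hu : ∀ i, 0 ≤ u i) :
    arctanN n u
      = n * ∫ t in Ioi (0 : ℝ), Real.exp (-t ^ n) * ∏ i, expNegPowPrimitive n (t * u i) := by
  have hn' : (n : ℝ) ≠ 0 := Nat.cast_ne_zero.2 hn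
  set B : Set (Fin (n - 1) → ℝ) := univ.pi fun i => Icc 0 (u i) with hB
  have hBm : MeasurableSet B := MeasurableSet.univ_pi fun i => measurableSet_Icc
  have hBc : IsCompact B := isCompact_univ_pi fun i => isCompact_Icc
  have hsum {x : Fin (n - 1) → ℝ} (hx : x ∈ B) : 0 ≤ ∑ i, x i ^ n :=
    Finset.sum_nonneg fun i _ => pow_nonneg (hx i (mem_univ i)).1 n
  let F (x : Fin (n - 1) → ℝ) (t : ℝ) : ℝ :=
    t ^ (n - 1) * Real.exp (-(t ^ n * (1 + ∑ i, x i ^ n)))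
  have hF : Integrable (Function.uncurry F)
      ((volume.restrict B).prod (volume.restrict (Ioi 0))) := by
    have : IsFiniteMeasure (volume.restrict B) := ⟨by simpa using hBc.measure_lt_top⟩
    refine ((integrable_const (1 : ℝ)).mul_prod
      (integrableOn_pow_mul_exp_neg_pow hn (n - 1))).mono'
      (by unfold F Function.uncurry; fun_prop : Continuous _).aestronglyMeasurable ?_
    rw [Measure.prod_restrict]
    filter_upwards [ae_restrict_mem (hBm.prod measurableSet_Ioi)] with ⟨x, t⟩ ⟨hx, ht⟩
    have ht0 : 0 ≤ t := (mem_Ioi.1 ht).le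
    simp only [Function.uncurry, F, one_mul]
    rw [Real.norm_of_nonneg (by positivity)]
    gcongr
    exact le_mul_of_one_le_right (by positivity) (by linarith [hsum hx])
  have hinner (t : ℝ) :
      ∫ x in B, F x t = Real.exp (-t ^ n) * ∏ i, expNegPowPrimitive n (t * u i) := by
    have hsplit (x : Fin (n - 1) → ℝ) :
        F x t = t ^ (n - 1) * Real.exp (-t ^ n) * ∏ i, Real.exp (-(t * x i) ^ n) := by
      rw [← Real.exp_sum, mul_assoc, ← Real.exp_add]
      simp only [F, mul_pow, Finset.sum_neg_distrib, ← Finset.mul_sum]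
      ring_nf
    simp_rw [hsplit, integral_const_mul, hB, volume_pi, Measure.restrict_pi_pi,
      integral_fintype_prod_eq_prod (fun _ (y : ℝ) => Real.exp (-(t * y) ^ n)),
      ← mul_integral_Icc_exp_neg_mul_pow n (hu _), Finset.prod_mul_distrib]
    simp only [Finset.prod_const, Finset.card_univ, Fintype.card_fin]
    ring
  simp_rw [← hinner]
  rw [← integral_integral_swap hF, arctanN, ← integral_const_mul]
  refine setIntegral_congr_fun hBm fun x hx => ?_
  simp only [F]
  rw [integral_Ioi_pow_mul_exp_neg_pow_mul hn (by linarith [hsum hx])]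
  field_simp

theorem arctanN_dual_eq_integral {n : ℕ} (hn : n ≠ 0) {u : Fin (n - 1) → ℝ} (hu : ∀ i, 0 < u i)
    (p : Fin (n - 1)) :
    arctanN n (fun q => if q = p then 1 / u p else u q / u p)
      = n * ∫ s in Ioi (0 : ℝ), expNegPowPrimitive n s *
          ((∏ q ∈ Finset.univ.erase p, expNegPowPrimitive n (s * u q)) *
            (Real.exp (-(s * u p) ^ n) * u p)) := by
  have hp : u p ≠ 0 := (hu p).ne'
  rw [arctanN_eq_integral hn fun q => by split_ifs <;> have := hu q <;> have := hu p <;> positivity]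
  have h := integral_comp_mul_right_Ioi' (fun t : ℝ => Real.exp (-t ^ n) *
    ∏ q, expNegPowPrimitive n (t * if q = p then 1 / u p else u q / u p)) 0 (hu p)
  rw [zero_mul] at h
  rw [← h, smul_eq_mul, ← integral_const_mul]
  congr 2 with s
  rw [← Finset.mul_prod_erase _ _ (Finset.mem_univ p)]
  have herase : ∏ q ∈ Finset.univ.erase p,
      expNegPowPrimitive n (s * u p * if q = p then 1 / u p else u q / u p)
      = ∏ q ∈ Finset.univ.erase p, expNegPowPrimitive n (s * u q) :=
    Finset.prod_congr rfl fun q hq => by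
      rw [if_neg (Finset.ne_of_mem_erase hq)]
      congr 1
      field_simp
  rw [herase, if_pos rfl, mul_assoc s, mul_one_div_cancel hp, mul_one]
  ring

theorem hasDerivAt_expNegPowPrimitive_mul_prod {ι : Type*} [Fintype ι] [DecidableEq ι]
    (n : ℕ) (u : ι → ℝ) (s : ℝ) :
    HasDerivAt (fun s => expNegPowPrimitive n s * ∏ i, expNegPowPrimitive n (s * u i))
      (Real.exp (-s ^ n) * ∏ i, expNegPowPrimitive n (s * u i) +
        ∑ p, expNegPowPrimitive n s *
          ((∏ q ∈ Finset.univ.erase p, expNegPowPrimitive n (s * u q)) *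
            (Real.exp (-(s * u p) ^ n) * u p))) s := by
  have hcomp (i : ι) : HasDerivAt (fun s => expNegPowPrimitive n (s * u i))
      (Real.exp (-(s * u i) ^ n) * u i) s :=
    HasDerivAt.comp (h := fun s => s * u i) s (hasDerivAt_expNegPowPrimitive n (s * u i))
      (hasDerivAt_mul_const (u i))
  rw [← Finset.mul_sum]
  simpa only [smul_eq_mul] using (hasDerivAt_expNegPowPrimitive n s).fun_mul
    (HasDerivAt.fun_finsetProd (u := Finset.univ) fun i _ => hcomp i)

theorem tendsto_expNegPowPrimitive_mul_prod {ι : Type*} [Fintype ι] {n : ℕ} (hn : n ≠ 0)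
    {u : ι → ℝ} (hu : ∀ i, 0 < u i) :
    Tendsto (fun s => expNegPowPrimitive n s * ∏ i, expNegPowPrimitive n (s * u i)) atTop
      (𝓝 ((1 / n * Real.Gamma (1 / n)) ^ (Fintype.card ι + 1))) := by
  have h := (tendsto_expNegPowPrimitive hn).mul <| tendsto_finsetProd Finset.univ fun i _ =>
    (tendsto_expNegPowPrimitive hn).comp (tendsto_id.atTop_mul_const (hu i))
  simpa only [Finset.prod_const, Finset.card_univ, pow_succ', Function.comp_apply, id] using h

theorem integrableOn_primitive_mul_prod_erase {ι : Type*} [Fintype ι] [DecidableEq ι]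
    {n : ℕ} (hn : n ≠ 0) {u : ι → ℝ} (hu : ∀ i, 0 < u i) (p : ι) :
    IntegrableOn (fun s => expNegPowPrimitive n s *
      ((∏ q ∈ Finset.univ.erase p, expNegPowPrimitive n (s * u q)) *
        (Real.exp (-(s * u p) ^ n) * u p))) (Ioi 0) := by
  have hexp : IntegrableOn (fun s => Real.exp (-(s * u p) ^ n)) (Ioi 0) := by
    simpa using (integrableOn_Ioi_comp_mul_right_iff
      (fun t : ℝ => Real.exp (-t ^ n)) 0 (hu p)).2 (by simpa using integrableOn_exp_neg_pow hn)
  have hL {s : ℝ} (hs : 0 ≤ s) : ‖expNegPowPrimitive n s‖ ≤ 1 / n * Real.Gamma (1 / n) := by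
    rw [Real.norm_of_nonneg (expNegPowPrimitive_nonneg n hs)]
    exact expNegPowPrimitive_le hn
  refine Integrable.bdd_mul (c := 1 / n * Real.Gamma (1 / n)) ?_
    (continuous_expNegPowPrimitive n).aestronglyMeasurable ?_
  · refine (hexp.mul_const (u p)).bdd_mul
      (c := ∏ _q ∈ Finset.univ.erase p, (1 / n * Real.Gamma (1 / n)))
      (by fun_prop : Continuous _).aestronglyMeasurable ?_
    filter_upwards [ae_restrict_mem measurableSet_Ioi] with s hs
    rw [norm_prod]
    exact Finset.prod_le_prod (fun _ _ => norm_nonneg _)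
      fun q _ => hL (mul_nonneg (mem_Ioi.1 hs).le (hu q).le)
  · filter_upwards [ae_restrict_mem measurableSet_Ioi] with s hs using hL (mem_Ioi.1 hs).le

/-- The functional equation of the `n`-th order arctan:
`arctanₙ(u) + Σ_{p} arctanₙ(u₁/u_p, …, 1/u_p, …, u_{n-1}/u_p) = n · ((1/n)·Γ(1/n))ⁿ`. -/
theorem arctanN_functional_equation (n : ℕ) (hn : 2 ≤ n)
    (u : Fin (n - 1) → ℝ) (hu : ∀ i, 0 < u i) :
    arctanN n u
      + ∑ p : Fin (n - 1),
          arctanN n (fun q => if q = p then 1 / u p else u q / u p)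
      = n * ((1 / n) * Real.Gamma (1 / n)) ^ n := by
  have hn0 : n ≠ 0 := by omega
  have hint := integrableOn_exp_neg_pow_mul_prod hn0 Finset.univ fun i => (hu i).le
  have hints := integrableOn_primitive_mul_prod_erase hn0 hu
  have hftc := integral_Ioi_of_hasDerivAt_of_tendsto'
    (fun s _ => hasDerivAt_expNegPowPrimitive_mul_prod n u s)
    (hint.add (integrable_finsetSum _ fun p _ => hints p))
    (tendsto_expNegPowPrimitive_mul_prod hn0 hu)
  rw [integral_add hint (integrable_finsetSum _ fun p _ => hints p),
    integral_finsetSum _ fun p _ => hints p, Fintype.card_fin,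
    Nat.sub_add_cancel (by omega)] at hftc
  simp_rw [arctanN_dual_eq_integral hn0 hu, arctanN_eq_integral hn0 fun i => (hu i).le]
  rw [← Finset.mul_sum, ← mul_add, hftc]
  simp [expNegPowPrimitive]
end

section
/- For every natural number n ≥ 2, ∫₀^1 ⋯ ∫₀^1 1/(1 + x₁ⁿ + ⋯ + x_{n-1}ⁿ) dx₁⋯dx_{n-1} = ((1/n) · Γ(1/n))ⁿ, where the integral is over the unit cube [0,1]^{n-1} and Γ is the Gamma function. -/
open MeasureTheory

open Set Filter Topology in
/-- The derivative of `-exp (-c tⁿ⁺¹) / c` integrates to its total increment. -/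
theorem integrableOn_and_integral_succ_mul_pow_mul_exp_neg_mul_pow (m : ℕ) {c : ℝ} (hc : 0 < c) :
    IntegrableOn (fun t : ℝ => (m + 1) * t ^ m * Real.exp (-(c * t ^ (m + 1)))) (Ioi 0) ∧
      ∫ t in Ioi (0 : ℝ), (m + 1) * t ^ m * Real.exp (-(c * t ^ (m + 1))) = 1 / c := by
  have hderiv : ∀ t ∈ Ici (0 : ℝ), HasDerivAt (fun t : ℝ => -Real.exp (-(c * t ^ (m + 1))) / c)
      ((m + 1) * t ^ m * Real.exp (-(c * t ^ (m + 1)))) t := by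
    intro t _
    have h := ((((hasDerivAt_pow (m + 1) t).const_mul c).neg.exp).neg).div_const c
    convert! h using 1
    push_cast
    field_simp
    simp
  have hpos : ∀ t ∈ Ioi (0 : ℝ), 0 ≤ (m + 1) * t ^ m * Real.exp (-(c * t ^ (m + 1))) := by
    intro t ht
    have : (0 : ℝ) < t := ht
    positivity
  have hlim : Tendsto (fun t : ℝ => -Real.exp (-(c * t ^ (m + 1))) / c) atTop (𝓝 0) := by
    have h := (Real.tendsto_exp_neg_atTop_nhds_zero.comp
      ((tendsto_pow_atTop (α := ℝ) m.succ_ne_zero).const_mul_atTop hc)).neg.div_const c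
    simpa [Function.comp_def] using h
  refine ⟨integrableOn_Ioi_deriv_of_nonneg' hderiv hpos hlim, ?_⟩
  rw [integral_Ioi_of_hasDerivAt_of_nonneg' hderiv hpos hlim]
  simp [neg_div]

open Set Filter Topology in
/-- The fundamental theorem of calculus for the `n`-th power of a primitive of `f`. -/
theorem integral_Ioi_succ_mul_pow_intervalIntegral_mul {f : ℝ → ℝ} (hf : Continuous f)
    (hf₀ : ∀ t, 0 ≤ f t) (hfi : IntegrableOn f (Ioi 0)) (m : ℕ) :
    ∫ t in Ioi (0 : ℝ), (m + 1) * (∫ u in (0 : ℝ)..t, f u) ^ m * f t =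
      (∫ t in Ioi (0 : ℝ), f t) ^ (m + 1) := by
  have hderiv : ∀ t ∈ Ici (0 : ℝ), HasDerivAt (fun t => (∫ u in (0 : ℝ)..t, f u) ^ (m + 1))
      ((m + 1) * (∫ u in (0 : ℝ)..t, f u) ^ m * f t) t := fun t _ => by
    simpa using (hf.integral_hasStrictDerivAt 0 t).hasDerivAt.fun_pow (m + 1)
  have hpos : ∀ t ∈ Ioi (0 : ℝ), 0 ≤ (m + 1) * (∫ u in (0 : ℝ)..t, f u) ^ m * f t := fun t ht => by
    have h₁ : 0 ≤ ∫ u in (0 : ℝ)..t, f u :=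
      intervalIntegral.integral_nonneg (le_of_lt ht) fun u _ => hf₀ u
    have h₂ := hf₀ t
    positivity
  rw [integral_Ioi_of_hasDerivAt_of_nonneg' hderiv hpos
    ((intervalIntegral_tendsto_integral_Ioi 0 hfi tendsto_id).pow (m + 1))]
  simp

open Set in
theorem integral_Ioi_exp_neg_pow_succ (m : ℕ) :
    ∫ t in Ioi (0 : ℝ), Real.exp (-t ^ (m + 1)) =
      1 / ((m + 1 : ℕ) : ℝ) * Real.Gamma (1 / ((m + 1 : ℕ) : ℝ)) := by
  have h := integral_exp_neg_rpow (p := ((m + 1 : ℕ) : ℝ)) (by positivity)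
  rw [Real.Gamma_add_one (by positivity)] at h
  simpa only [Real.rpow_natCast] using h

open Set in
theorem integrableOn_Ioi_exp_neg_pow_succ (m : ℕ) :
    IntegrableOn (fun t : ℝ => Real.exp (-t ^ (m + 1))) (Ioi 0) := by
  have h := integrableOn_rpow_mul_exp_neg_rpow (p := ((m + 1 : ℕ) : ℝ)) (s := 0)
    (by norm_num) (by positivity)
  simpa only [Real.rpow_natCast, Real.rpow_zero, one_mul] using h

open Set in
/-- Scaling of the unit cube to the cube of side `t`. -/
theorem integral_unit_cube_prod_comp_mul (f : ℝ → ℝ) (m : ℕ) (t : ℝ) :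
    t ^ m * ∫ x in univ.pi (fun _ : Fin m => Icc (0 : ℝ) 1), ∏ i, f (t * x i) =
      (∫ u in (0 : ℝ)..t, f u) ^ m := by
  rw [volume_pi, Measure.restrict_pi_pi, integral_fintype_prod_eq_pow (fun u => f (t * u)),
    Fintype.card_fin, ← mul_pow, integral_Icc_eq_integral_Ioc,
    ← intervalIntegral.integral_of_le zero_le_one, ← smul_eq_mul,
    intervalIntegral.smul_integral_comp_mul_left]
  simp

open Set in
theorem integral_unit_cube_one_div_one_add_sum_pow_succ (m : ℕ) :
    ∫ x in univ.pi (fun _ : Fin m => Icc (0 : ℝ) 1), 1 / (1 + ∑ i, x i ^ (m + 1)) =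
      (∫ t in Ioi (0 : ℝ), Real.exp (-t ^ (m + 1))) ^ (m + 1) := by
  have hmeas : MeasurableSet (univ.pi (fun _ : Fin m => Icc (0 : ℝ) 1)) :=
    MeasurableSet.univ_pi fun _ => measurableSet_Icc
  have : IsFiniteMeasure (volume.restrict (univ.pi (fun _ : Fin m => Icc (0 : ℝ) 1))) :=
    ⟨by simpa using (isCompact_univ_pi fun _ : Fin m => isCompact_Icc).measure_lt_top⟩
  let G : (Fin m → ℝ) → ℝ → ℝ := fun x t =>
    (m + 1) * t ^ m * Real.exp (-t ^ (m + 1)) * ∏ i, Real.exp (-(t * x i) ^ (m + 1))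
  have hG : ∀ x t, G x t =
      (m + 1) * t ^ m * Real.exp (-((1 + ∑ i, x i ^ (m + 1)) * t ^ (m + 1))) := by
    intro x t
    simp only [G]
    rw [← Real.exp_sum, mul_assoc, ← Real.exp_add]
    congr 2
    simp only [mul_pow, Finset.sum_neg_distrib, ← Finset.mul_sum]
    ring
  have hint : Integrable (Function.uncurry G)
      ((volume.restrict (univ.pi fun _ : Fin m => Icc (0 : ℝ) 1)).prod
        (volume.restrict (Ioi 0))) := by
    have hdom := (integrable_const (1 : ℝ)).mul_prod
      (μ := volume.restrict (univ.pi fun _ : Fin m => Icc (0 : ℝ) 1))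
      (integrableOn_and_integral_succ_mul_pow_mul_exp_neg_mul_pow m one_pos).1
    refine hdom.mono' (Continuous.aestronglyMeasurable (by unfold G; fun_prop)) ?_
    rw [Measure.prod_restrict]
    refine (ae_restrict_iff' (hmeas.prod measurableSet_Ioi)).2 (.of_forall fun z hz => ?_)
    have ht : 0 < z.2 := hz.2
    have hx : ∀ i, 0 ≤ z.1 i := fun i => (hz.1 i (mem_univ i)).1
    have hprod : ∏ i, Real.exp (-(z.2 * z.1 i) ^ (m + 1)) ≤ 1 :=
      Finset.prod_le_one (fun i _ => (Real.exp_pos _).le) fun i _ =>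
        Real.exp_le_one_iff.2 (neg_nonpos.2 (pow_nonneg (mul_nonneg ht.le (hx i)) _))
    have hfac : 0 ≤ (m + 1) * z.2 ^ m * Real.exp (-z.2 ^ (m + 1)) := by positivity
    rw [Function.uncurry, Real.norm_of_nonneg
      (mul_nonneg hfac (Finset.prod_nonneg fun i _ => (Real.exp_pos _).le))]
    simpa using mul_le_of_le_one_right hfac hprod
  calc
    _ = ∫ x in univ.pi (fun _ : Fin m => Icc (0 : ℝ) 1), ∫ t in Ioi (0 : ℝ), G x t := by
      refine setIntegral_congr_fun hmeas fun x hx => ?_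
      have hc : 0 < 1 + ∑ i, x i ^ (m + 1) := by
        have := Finset.sum_nonneg fun i (_ : i ∈ Finset.univ) =>
          pow_nonneg (hx i (mem_univ i)).1 (m + 1)
        linarith
      simp only [hG]
      exact (integrableOn_and_integral_succ_mul_pow_mul_exp_neg_mul_pow m hc).2.symm
    _ = ∫ t in Ioi (0 : ℝ), ∫ x in univ.pi (fun _ : Fin m => Icc (0 : ℝ) 1), G x t :=
      integral_integral_swap hint
    _ = ∫ t in Ioi (0 : ℝ), (m + 1) * (∫ u in (0 : ℝ)..t, Real.exp (-u ^ (m + 1))) ^ m *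
          Real.exp (-t ^ (m + 1)) := by
      congr 1 with t
      rw [integral_const_mul,
        ← integral_unit_cube_prod_comp_mul (fun u => Real.exp (-u ^ (m + 1)))]
      ring
    _ = _ := integral_Ioi_succ_mul_pow_intervalIntegral_mul (by fun_prop)
      (fun _ => (Real.exp_pos _).le) (integrableOn_Ioi_exp_neg_pow_succ m) m

/-- For `n ≥ 2`,
`∫_{[0,1]^{n-1}} 1/(1 + x₁ⁿ + ⋯ + x_{n-1}ⁿ) = ((1/n)·Γ(1/n))ⁿ`. -/
theorem integral_unit_cube_one_div_one_add_sum_pow (n : ℕ) (hn : 2 ≤ n) :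
    ∫ x in Set.univ.pi (fun _ : Fin (n - 1) => Set.Icc (0:ℝ) 1),
        1 / (1 + ∑ i, x i ^ n)
      = ((1 / n) * Real.Gamma (1 / n)) ^ n := by
  obtain ⟨m, rfl⟩ : ∃ m, n = m + 1 := ⟨n - 1, by omega⟩
  rw [← integral_Ioi_exp_neg_pow_succ]
  exact integral_unit_cube_one_div_one_add_sum_pow_succ m
end

section
/- For every natural number n ≥ 2, ∫₀^{+∞} ⋯ ∫₀^{+∞} 1/(1 + x₁ⁿ + ⋯ + x_{n-1}ⁿ) dx₁⋯dx_{n-1} = n · ((1/n) · Γ(1/n))ⁿ, where the integral is over the positive orthant [0,∞)^{n-1} and Γ is the Gamma function. -/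
open MeasureTheory

lemma integral_Ici_exp_neg_mul_pow {n : ℕ} (hn : n ≠ 0) {t : ℝ} (ht : 0 < t) :
    ∫ x in Set.Ici (0 : ℝ), Real.exp (-t * x ^ n)
      = t ^ (-(1 / n : ℝ)) * Real.Gamma (1 / n + 1) := by
  have h := integral_exp_neg_mul_rpow (p := n) (by positivity) ht
  simp only [Real.rpow_natCast] at h
  rw [integral_Ici_eq_integral_Ioi, h, neg_div]

lemma integrableOn_Ici_exp_neg_mul_pow {n : ℕ} (hn : n ≠ 0) {t : ℝ} (ht : 0 < t) :
    IntegrableOn (fun x : ℝ => Real.exp (-t * x ^ n)) (Set.Ici 0) := by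
  refine .of_integral_ne_zero ?_
  rw [integral_Ici_exp_neg_mul_pow hn ht]
  have := Real.Gamma_pos_of_pos (show (0 : ℝ) < 1 / n + 1 by positivity)
  positivity

lemma exp_neg_mul_one_add_sum {ι : Type*} [Fintype ι] (n : ℕ) (t : ℝ) (x : ι → ℝ) :
    Real.exp (-t * (1 + ∑ i, x i ^ n))
      = Real.exp (-t) * ∏ i, Real.exp (-t * x i ^ n) := by
  rw [← Real.exp_sum, ← Real.exp_add, mul_add, mul_one, Finset.mul_sum]

lemma integral_Ioi_exp_neg_mul {a : ℝ} (ha : 0 < a) :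
    ∫ t in Set.Ioi (0 : ℝ), Real.exp (-t * a) = 1 / a := by
  have h := integral_exp_mul_Ioi (neg_lt_zero.2 ha) 0
  simp only [mul_zero, Real.exp_zero, neg_div_neg_eq] at h
  rw [← h]
  exact integral_congr_ae (.of_forall fun t => by ring_nf)

/-- The integral of `1 / (1 + ∑ i, x i ^ n)` over the positive orthant of dimension `m < n`. -/
lemma integral_orthant_eq_Gamma_mul_Gamma {ι : Type*} [Fintype ι] {n : ℕ}
    (hι : Fintype.card ι < n) :
    ∫ x in Set.univ.pi (fun _ : ι => Set.Ici (0 : ℝ)), 1 / (1 + ∑ i, x i ^ n)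
      = Real.Gamma (1 / n + 1) ^ Fintype.card ι * Real.Gamma (1 - Fintype.card ι / n) := by
  have hn : n ≠ 0 := by omega
  have hn' : (0 : ℝ) < n := by positivity
  have hs : (0 : ℝ) < 1 - Fintype.card ι / n := by
    rw [sub_pos, div_lt_one hn']
    exact_mod_cast hι
  set μ : Measure (ι → ℝ) := Measure.pi fun _ => volume.restrict (Set.Ici 0) with hμ
  have hvol : volume.restrict (Set.univ.pi fun _ : ι => Set.Ici (0 : ℝ)) = μ := by
    rw [volume_pi, Measure.restrict_pi_pi]
  have hint (t : ℝ) (ht : t ∈ Set.Ioi (0 : ℝ)) :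
      Integrable (fun x => Real.exp (-t * (1 + ∑ i, x i ^ n))) μ := by
    simp_rw [exp_neg_mul_one_add_sum]
    exact (Integrable.fintype_prod fun _ => integrableOn_Ici_exp_neg_mul_pow hn ht).const_mul _
  have hval (t : ℝ) (ht : t ∈ Set.Ioi (0 : ℝ)) :
      ∫ x, Real.exp (-t * (1 + ∑ i, x i ^ n)) ∂μ
        = Real.Gamma (1 / n + 1) ^ Fintype.card ι
          * (Real.exp (-t) * t ^ ((1 - Fintype.card ι / n : ℝ) - 1)) := by
    simp_rw [exp_neg_mul_one_add_sum]
    rw [integral_const_mul, hμ, integral_fintype_prod_eq_pow (fun x : ℝ => Real.exp (-t * x ^ n)),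
      integral_Ici_exp_neg_mul_pow hn ht, mul_pow, ← Real.rpow_mul_natCast (le_of_lt ht)]
    ring_nf
  have hprod : Integrable (fun z : (ι → ℝ) × ℝ => Real.exp (-z.2 * (1 + ∑ i, z.1 i ^ n)))
      (μ.prod (volume.restrict (Set.Ioi 0))) := by
    rw [integrable_prod_iff' (by fun_prop)]
    refine ⟨(ae_restrict_iff' measurableSet_Ioi).2 (.of_forall hint), ?_⟩
    simp only [Real.norm_eq_abs, Real.abs_exp]
    exact IntegrableOn.congr_fun ((Real.GammaIntegral_convergent hs).const_mul _)
      (fun t ht => (hval t ht).symm) measurableSet_Ioi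
  calc
    _ = ∫ x, (∫ t in Set.Ioi (0 : ℝ), Real.exp (-t * (1 + ∑ i, x i ^ n))) ∂μ := by
      rw [← hvol]
      refine setIntegral_congr_fun (.univ_pi fun _ => measurableSet_Ici) fun x hx => ?_
      refine (integral_Ioi_exp_neg_mul ?_).symm
      have : 0 ≤ ∑ i, x i ^ n := Finset.sum_nonneg fun i _ => pow_nonneg (hx i trivial) n
      positivity
    _ = ∫ t in Set.Ioi (0 : ℝ), ∫ x, Real.exp (-t * (1 + ∑ i, x i ^ n)) ∂μ :=
      integral_integral_swap hprod
    _ = _ := by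
      rw [setIntegral_congr_fun measurableSet_Ioi hval, integral_const_mul,
        ← Real.Gamma_eq_integral hs]

/-- For `n ≥ 2`,
`∫_{[0,∞)^{n-1}} 1/(1 + x₁ⁿ + ⋯ + x_{n-1}ⁿ) = n · ((1/n)·Γ(1/n))ⁿ`. -/
theorem integral_orthant_one_div_one_add_sum_pow (n : ℕ) (hn : 2 ≤ n) :
    ∫ x in Set.univ.pi (fun _ : Fin (n - 1) => Set.Ici (0:ℝ)),
        1 / (1 + ∑ i, x i ^ n)
      = n * ((1 / n) * Real.Gamma (1 / n)) ^ n := by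
  obtain ⟨m, rfl⟩ : ∃ m, n = m + 1 := ⟨n - 1, by omega⟩
  have hm : ((m + 1 : ℕ) : ℝ) ≠ 0 := by positivity
  have hs : 1 - (m : ℝ) / (m + 1 : ℕ) = 1 / (m + 1 : ℕ) := by
    field_simp
    push_cast
    ring
  rw [integral_orthant_eq_Gamma_mul_Gamma (by simp), Real.Gamma_add_one (by positivity)]
  simp only [Fintype.card_fin, Nat.add_sub_cancel]
  rw [hs, pow_succ]
  field_simp
end

section
/- ∫₀^1 ∫₀^1 1/(1 + x³ + y³) dx dy = ((1/3) · Γ(1/3))³, where Γ is the Gamma function. -/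
open MeasureTheory

open Set Filter Topology

lemma tendsto_intervalIntegral_exp_neg_cube :
    Tendsto (fun z : ℝ => ∫ x in (0:ℝ)..z, Real.exp (-x ^ 3)) atTop
      (𝓝 ((1 / 3) * Real.Gamma (1 / 3))) := by
  have hint : IntegrableOn (fun x : ℝ => Real.exp (-x ^ 3)) (Ioi 0) := by
    refine (integrableOn_rpow_mul_exp_neg_rpow (p := 3) (s := 0) (by norm_num)
      (by norm_num)).congr_fun (fun x _ => ?_) measurableSet_Ioi
    norm_cast
    simp
  have hval : ∫ x in Ioi (0:ℝ), Real.exp (-x ^ 3) = (1 / 3) * Real.Gamma (1 / 3) := by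
    rw [← Real.Gamma_add_one (by norm_num), ← integral_exp_neg_rpow (by norm_num : (0:ℝ) < 3)]
    norm_cast
  rw [← hval]
  exact intervalIntegral_tendsto_integral_Ioi 0 hint tendsto_id

lemma hasDerivAt_neg_exp_neg_mul_cube_div {c : ℝ} (hc : c ≠ 0) (z : ℝ) :
    HasDerivAt (fun z : ℝ => -Real.exp (-(c * z ^ 3)) / c)
      (3 * z ^ 2 * Real.exp (-(c * z ^ 3))) z := by
  refine ((((hasDerivAt_pow 3 z).const_mul c).neg.exp.neg).div_const c).congr_deriv ?_
  field_simp
  simp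
  ring

lemma tendsto_neg_exp_neg_mul_cube_div {c : ℝ} (hc : 0 < c) :
    Tendsto (fun z : ℝ => -Real.exp (-(c * z ^ 3)) / c) atTop (𝓝 0) := by
  have h : Tendsto (fun z : ℝ => Real.exp (-(c * z ^ 3))) atTop (𝓝 0) :=
    Real.tendsto_exp_neg_atTop_nhds_zero.comp
      ((tendsto_pow_atTop (by norm_num)).const_mul_atTop hc)
  simpa using h.neg.div_const c

lemma integrableOn_sq_mul_exp_neg_mul_cube {c : ℝ} (hc : 0 < c) :
    IntegrableOn (fun z : ℝ => 3 * z ^ 2 * Real.exp (-(c * z ^ 3))) (Ioi 0) :=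
  integrableOn_Ioi_deriv_of_nonneg'
    (fun z _ => hasDerivAt_neg_exp_neg_mul_cube_div hc.ne' z) (fun z _ => by positivity)
    (tendsto_neg_exp_neg_mul_cube_div hc)

lemma integral_sq_mul_exp_neg_mul_cube {c : ℝ} (hc : 0 < c) :
    ∫ z in Ioi (0:ℝ), 3 * z ^ 2 * Real.exp (-(c * z ^ 3)) = 1 / c := by
  rw [integral_Ioi_of_hasDerivAt_of_nonneg'
    (fun z _ => hasDerivAt_neg_exp_neg_mul_cube_div hc.ne' z) (fun z _ => by positivity)
    (tendsto_neg_exp_neg_mul_cube_div hc)]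
  simp [neg_div]

lemma integral_mul_sq_intervalIntegral_exp_neg_cube :
    ∫ z in Ioi (0:ℝ), 3 * (∫ x in (0:ℝ)..z, Real.exp (-x ^ 3)) ^ 2 * Real.exp (-z ^ 3)
      = ((1 / 3) * Real.Gamma (1 / 3)) ^ 3 := by
  have hcont : Continuous fun x : ℝ => Real.exp (-x ^ 3) := by fun_prop
  rw [integral_Ioi_of_hasDerivAt_of_nonneg'
    (g := fun z => (∫ x in (0:ℝ)..z, Real.exp (-x ^ 3)) ^ 3)
    (fun z _ => ?_) (fun z _ => by positivity) (tendsto_intervalIntegral_exp_neg_cube.pow 3)]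
  · simp
  · exact (intervalIntegral.integral_hasDerivAt_right (hcont.intervalIntegrable _ _)
      hcont.aestronglyMeasurable.stronglyMeasurableAtFilter hcont.continuousAt).pow 3

lemma setIntegral_unitSquare_sq_mul_exp_neg_cubes (z : ℝ) :
    ∫ p in Icc (0:ℝ) 1 ×ˢ Icc (0:ℝ) 1,
        3 * z ^ 2 * Real.exp (-((1 + p.1 ^ 3 + p.2 ^ 3) * z ^ 3))
      = 3 * (∫ x in (0:ℝ)..z, Real.exp (-x ^ 3)) ^ 2 * Real.exp (-z ^ 3) := by
  have hscale : ∫ x in (0:ℝ)..z, Real.exp (-x ^ 3)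
      = z * ∫ u in Icc (0:ℝ) 1, Real.exp (-(z * u) ^ 3) := by
    rw [integral_Icc_eq_integral_Ioc, ← intervalIntegral.integral_of_le zero_le_one,
      intervalIntegral.mul_integral_comp_mul_left (f := fun x => Real.exp (-x ^ 3))]
    simp
  have hfactor (p : ℝ × ℝ) : 3 * z ^ 2 * Real.exp (-((1 + p.1 ^ 3 + p.2 ^ 3) * z ^ 3))
      = 3 * z ^ 2 * Real.exp (-z ^ 3)
        * (Real.exp (-(z * p.1) ^ 3) * Real.exp (-(z * p.2) ^ 3)) := by
    rw [mul_assoc _ (Real.exp _), ← Real.exp_add, ← Real.exp_add]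
    ring_nf
  simp_rw [hfactor]
  rw [integral_const_mul, Measure.volume_eq_prod,
    setIntegral_prod_mul (fun u : ℝ => Real.exp (-(z * u) ^ 3))
      (fun u : ℝ => Real.exp (-(z * u) ^ 3)), hscale]
  ring

lemma integrable_sq_mul_exp_neg_cubes :
    Integrable (Function.uncurry fun (p : ℝ × ℝ) (z : ℝ) =>
        3 * z ^ 2 * Real.exp (-((1 + p.1 ^ 3 + p.2 ^ 3) * z ^ 3)))
      ((volume.restrict (Icc (0:ℝ) 1 ×ˢ Icc (0:ℝ) 1)).prod (volume.restrict (Ioi 0))) := by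
  have hfin : IsFiniteMeasure
      ((volume : Measure (ℝ × ℝ)).restrict (Icc (0:ℝ) 1 ×ˢ Icc (0:ℝ) 1)) :=
    isFiniteMeasure_restrict.2 (isCompact_Icc.prod isCompact_Icc).measure_lt_top.ne
  refine ((integrableOn_sq_mul_exp_neg_mul_cube one_pos).comp_snd _).mono'
    (by unfold Function.uncurry; fun_prop) ?_
  rw [Measure.prod_restrict]
  filter_upwards [ae_restrict_mem ((measurableSet_Icc.prod measurableSet_Icc).prod
    measurableSet_Ioi)] with ⟨⟨x, y⟩, z⟩ ⟨⟨⟨hx, _⟩, ⟨hy, _⟩⟩, hz⟩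
  have hz : 0 < z := hz
  have hx : 0 ≤ x := hx
  have hy : 0 ≤ y := hy
  have : 0 ≤ x ^ 3 + y ^ 3 := by positivity
  simp only [Function.uncurry]
  rw [Real.norm_of_nonneg (by positivity)]
  gcongr
  linarith

/-- `∫₀^1 ∫₀^1 1/(1 + x³ + y³) dx dy = ((1/3)·Γ(1/3))³`. -/
theorem integral_unit_square_one_div_one_add_cubes :
    ∫ p in Set.Icc (0:ℝ) 1 ×ˢ Set.Icc (0:ℝ) 1, 1 / (1 + p.1 ^ 3 + p.2 ^ 3)
      = ((1 / 3) * Real.Gamma (1 / 3)) ^ 3 := by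
  calc
    _ = ∫ p in Icc (0:ℝ) 1 ×ˢ Icc (0:ℝ) 1, ∫ z in Ioi (0:ℝ),
          3 * z ^ 2 * Real.exp (-((1 + p.1 ^ 3 + p.2 ^ 3) * z ^ 3)) := by
      refine setIntegral_congr_fun (measurableSet_Icc.prod measurableSet_Icc) ?_
      rintro ⟨x, y⟩ ⟨⟨hx, _⟩, ⟨hy, _⟩⟩
      have hx : 0 ≤ x := hx
      have hy : 0 ≤ y := hy
      exact (integral_sq_mul_exp_neg_mul_cube (by positivity)).symm
    _ = ∫ z in Ioi (0:ℝ), ∫ p in Icc (0:ℝ) 1 ×ˢ Icc (0:ℝ) 1,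
          3 * z ^ 2 * Real.exp (-((1 + p.1 ^ 3 + p.2 ^ 3) * z ^ 3)) :=
      integral_integral_swap integrable_sq_mul_exp_neg_cubes
    _ = _ := by
      simp_rw [setIntegral_unitSquare_sq_mul_exp_neg_cubes]
      exact integral_mul_sq_intervalIntegral_exp_neg_cube
end

section
/- ∫₀^{+∞} ∫₀^{+∞} 1/(1 + x³ + y³) dx dy = 3 · ((1/3) · Γ(1/3))³, where Γ is the Gamma function. -/
open MeasureTheory

theorem lintegral_ofReal_eq_of_integral_pos {α : Type*} [MeasurableSpace α] {μ : Measure α}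
    {f : α → ℝ} (hf : 0 ≤ᵐ[μ] f) {c : ℝ} (hc : 0 < c) (h : ∫ x, f x ∂μ = c) :
    ∫⁻ x, ENNReal.ofReal (f x) ∂μ = ENNReal.ofReal c := by
  have hi : Integrable f μ := .of_integral_ne_zero (by rw [h]; exact hc.ne')
  rw [← ofReal_integral_eq_lintegral_ofReal hi hf, h]

theorem lintegral_Ioi_exp_neg_mul {a : ℝ} (ha : 0 < a) :
    ∫⁻ t in Set.Ioi (0:ℝ), ENNReal.ofReal (Real.exp (-a * t)) = ENNReal.ofReal (1 / a) := by
  refine lintegral_ofReal_eq_of_integral_pos (.of_forall fun t => (Real.exp_pos _).le)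
    (by positivity) ?_
  rw [integral_exp_mul_Ioi (neg_lt_zero.2 ha)]
  simp

theorem lintegral_Ioi_exp_neg_mul_cube {t : ℝ} (ht : 0 < t) :
    ∫⁻ x in Set.Ioi (0:ℝ), ENNReal.ofReal (Real.exp (-t * x ^ 3))
      = ENNReal.ofReal (t ^ (-1 / 3 : ℝ) * Real.Gamma (1 / 3 + 1)) := by
  have hG : 0 < Real.Gamma (1 / 3 + 1) := Real.Gamma_pos_of_pos (by norm_num)
  refine lintegral_ofReal_eq_of_integral_pos (.of_forall fun t => (Real.exp_pos _).le)
    (by positivity) ?_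
  have h := integral_exp_neg_mul_rpow (p := 3) (by norm_num) ht
  norm_cast at h ⊢

theorem lintegral_Ioi_exp_neg_mul_rpow :
    ∫⁻ t in Set.Ioi (0:ℝ), ENNReal.ofReal (Real.exp (-t) * t ^ (-2 / 3 : ℝ))
      = ENNReal.ofReal (Real.Gamma (1 / 3)) := by
  have hG : 0 < Real.Gamma (1 / 3) := Real.Gamma_pos_of_pos (by norm_num)
  refine lintegral_ofReal_eq_of_integral_pos ?_ hG ?_
  · filter_upwards [ae_restrict_mem measurableSet_Ioi] with t ht
    have : (0:ℝ) < t := ht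
    positivity
  · rw [Real.Gamma_eq_integral (by norm_num)]
    norm_num

theorem lintegral_quadrant_one_div_one_add_cubes :
    ∫⁻ p, ENNReal.ofReal (1 / (1 + p.1 ^ 3 + p.2 ^ 3))
        ∂((volume.restrict (Set.Ioi (0:ℝ))).prod (volume.restrict (Set.Ioi (0:ℝ))))
      = ENNReal.ofReal (Real.Gamma (1 / 3 + 1) ^ 2 * Real.Gamma (1 / 3)) := by
  set μ := volume.restrict (Set.Ioi (0:ℝ)) with hμ
  have hG : 0 < Real.Gamma (1 / 3 + 1) := Real.Gamma_pos_of_pos (by norm_num)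
  calc
    _ = ∫⁻ p, ∫⁻ t, ENNReal.ofReal (Real.exp (-(1 + p.1 ^ 3 + p.2 ^ 3) * t)) ∂μ ∂(μ.prod μ) := by
      refine lintegral_congr_ae ?_
      have hmem : ∀ᵐ p ∂(μ.prod μ), p ∈ Set.Ioi (0:ℝ) ×ˢ Set.Ioi (0:ℝ) := by
        rw [hμ, Measure.prod_restrict]
        exact ae_restrict_mem (measurableSet_Ioi.prod measurableSet_Ioi)
      filter_upwards [hmem] with p hp
      have h₁ : 0 < p.1 := hp.1
      have h₂ : 0 < p.2 := hp.2
      exact (lintegral_Ioi_exp_neg_mul (by positivity)).symm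
    _ = ∫⁻ t, ∫⁻ p, ENNReal.ofReal (Real.exp (-(1 + p.1 ^ 3 + p.2 ^ 3) * t)) ∂(μ.prod μ) ∂μ :=
      lintegral_lintegral_swap (by unfold Function.uncurry; fun_prop)
    _ = ∫⁻ t, ENNReal.ofReal (Real.Gamma (1 / 3 + 1) ^ 2) *
          ENNReal.ofReal (Real.exp (-t) * t ^ (-2 / 3 : ℝ)) ∂μ := by
      refine lintegral_congr_ae ?_
      filter_upwards [ae_restrict_mem measurableSet_Ioi] with t ht
      have ht : 0 < t := ht
      have hsplit (p : ℝ × ℝ) : ENNReal.ofReal (Real.exp (-(1 + p.1 ^ 3 + p.2 ^ 3) * t)) =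
          ENNReal.ofReal (Real.exp (-t)) * (ENNReal.ofReal (Real.exp (-t * p.1 ^ 3)) *
            ENNReal.ofReal (Real.exp (-t * p.2 ^ 3))) := by
        rw [← ENNReal.ofReal_mul (by positivity), ← ENNReal.ofReal_mul (by positivity),
          ← Real.exp_add, ← Real.exp_add]
        ring_nf
      simp_rw [hsplit]
      rw [lintegral_const_mul _ (by fun_prop),
        lintegral_prod_mul (f := fun x : ℝ => ENNReal.ofReal (Real.exp (-t * x ^ 3)))
          (g := fun x : ℝ => ENNReal.ofReal (Real.exp (-t * x ^ 3))) (by fun_prop) (by fun_prop),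
        lintegral_Ioi_exp_neg_mul_cube ht, ← ENNReal.ofReal_mul (by positivity),
        ← ENNReal.ofReal_mul (by positivity), ← ENNReal.ofReal_mul (by positivity)]
      have hpow : t ^ (-2 / 3 : ℝ) = t ^ (-1 / 3 : ℝ) * t ^ (-1 / 3 : ℝ) := by
        rw [← Real.rpow_add ht]
        norm_num
      rw [hpow]
      ring_nf
    _ = _ := by
      rw [lintegral_const_mul _ (by fun_prop), lintegral_Ioi_exp_neg_mul_rpow,
        ← ENNReal.ofReal_mul (by positivity)]

/-- `∫₀^∞ ∫₀^∞ 1/(1 + x³ + y³) dx dy = 3 · ((1/3)·Γ(1/3))³`. -/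
theorem integral_quadrant_one_div_one_add_cubes :
    ∫ p in Set.Ici (0:ℝ) ×ˢ Set.Ici (0:ℝ), 1 / (1 + p.1 ^ 3 + p.2 ^ 3)
      = 3 * ((1 / 3) * Real.Gamma (1 / 3)) ^ 3 := by
  have hG : 0 < Real.Gamma (1 / 3) := Real.Gamma_pos_of_pos (by norm_num)
  rw [integral_eq_lintegral_of_nonneg_ae ?_ (Measurable.aestronglyMeasurable (by fun_prop)),
    Measure.volume_eq_prod, ← Measure.prod_restrict, ← restrict_Ioi_eq_restrict_Ici,
    lintegral_quadrant_one_div_one_add_cubes, ENNReal.toReal_ofReal (by positivity),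
    Real.Gamma_add_one (by norm_num)]
  · ring
  · filter_upwards [ae_restrict_mem (measurableSet_Ici.prod measurableSet_Ici)] with p hp
    have h₁ : 0 ≤ p.1 := hp.1
    have h₂ : 0 ≤ p.2 := hp.2
    positivity
end

section
/- For positive reals a, b, c, define arctan₄(a,b,c) = ∫₀^a ∫₀^b ∫₀^c 1/(1 + x⁴ + y⁴ + z⁴) dx dy dz. Then for all real numbers u > 0 and v > 0, arctan₄(u, v, u/v) + arctan₄(1/u, v/u, 1/v) + arctan₄(u/v, 1/v, u/v²) + arctan₄(v, v²/u, v/u) = 4 · ((1/4) · Γ(1/4))⁴. -/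
open MeasureTheory

/-- The fourth-order arctan: the Lebesgue integral of
`(x,y,z) ↦ 1/(1 + x⁴ + y⁴ + z⁴)` over the box `[0,a] × [0,b] × [0,c]`. -/
noncomputable def arctan4 (a b c : ℝ) : ℝ :=
  ∫ p in Set.Icc (0:ℝ) a ×ˢ Set.Icc (0:ℝ) b ×ˢ Set.Icc (0:ℝ) c,
    1 / (1 + p.1 ^ 4 + p.2.1 ^ 4 + p.2.2 ^ 4)

open Filter Topology

/-- The fourth-order analogue of the error function: `x ↦ ∫₀ˣ exp(-t⁴) dt`. -/
noncomputable def erf4 (x : ℝ) : ℝ := ∫ t in (0:ℝ)..x, Real.exp (-t ^ 4)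

lemma hasDerivAt_erf4 (x : ℝ) : HasDerivAt erf4 (Real.exp (-x ^ 4)) x :=
  (Continuous.integral_hasStrictDerivAt (f := fun t : ℝ => Real.exp (-t ^ 4))
    (by fun_prop) 0 x).hasDerivAt

lemma hasDerivAt_erf4_mul (k x : ℝ) :
    HasDerivAt (fun s => erf4 (k * s)) (k * Real.exp (-(k * x) ^ 4)) x := by
  have h := (hasDerivAt_erf4 (k * x)).comp x ((hasDerivAt_id x).const_mul k)
  simpa [Function.comp_def, mul_comm] using h

@[fun_prop]
lemma continuous_erf4 : Continuous erf4 :=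
  continuous_iff_continuousAt.2 fun x => (hasDerivAt_erf4 x).continuousAt

lemma erf4_zero : erf4 0 = 0 := by simp [erf4]

lemma integrableOn_exp_neg_pow_four :
    IntegrableOn (fun t : ℝ => Real.exp (-t ^ 4)) (Set.Ioi 0) := by
  have h := integrableOn_rpow_mul_exp_neg_rpow (s := 0) (p := 4) (by norm_num) (by norm_num)
  simpa only [Real.rpow_zero, one_mul, Real.rpow_ofNat] using h

lemma integral_exp_neg_pow_four :
    ∫ t in Set.Ioi (0:ℝ), Real.exp (-t ^ 4) = (1 / 4) * Real.Gamma (1 / 4) := by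
  have h := integral_exp_neg_rpow (p := 4) (by norm_num)
  rw [Real.Gamma_add_one (by norm_num)] at h
  exact mod_cast h

lemma tendsto_erf4 : Tendsto erf4 atTop (𝓝 ((1 / 4) * Real.Gamma (1 / 4))) := by
  rw [← integral_exp_neg_pow_four]
  exact intervalIntegral_tendsto_integral_Ioi 0 integrableOn_exp_neg_pow_four tendsto_id

lemma norm_erf4_le {x : ℝ} (hx : 0 ≤ x) : ‖erf4 x‖ ≤ (1 / 4) * Real.Gamma (1 / 4) := by
  rw [← integral_exp_neg_pow_four, erf4, intervalIntegral.integral_of_le hx, Real.norm_eq_abs,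
    abs_of_nonneg (integral_nonneg fun t => (Real.exp_pos _).le)]
  exact setIntegral_mono_set integrableOn_exp_neg_pow_four
    (ae_of_all _ fun t => (Real.exp_pos _).le) (Set.Ioc_subset_Ioi_self.eventuallyLE)

lemma integrableOn_pow_three_mul_exp_neg_pow_four :
    IntegrableOn (fun w : ℝ => w ^ 3 * Real.exp (-w ^ 4)) (Set.Ioi 0) := by
  have h := integrableOn_rpow_mul_exp_neg_rpow (s := 3) (p := 4) (by norm_num) (by norm_num)
  exact mod_cast h

lemma integral_pow_three_mul_exp_neg_mul_pow_four {b : ℝ} (hb : 0 < b) :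
    ∫ w in Set.Ioi (0:ℝ), w ^ 3 * Real.exp (-b * w ^ 4) = 1 / 4 * (1 / b) := by
  have h := integral_rpow_mul_exp_neg_mul_rpow (p := 4) (q := 3) (by norm_num) (by norm_num) hb
  simp only [Real.rpow_ofNat] at h
  rw [h]
  norm_num [Real.rpow_neg_one, mul_comm]

lemma mul_setIntegral_exp_neg_mul_pow_four {a : ℝ} (ha : 0 ≤ a) (w : ℝ) :
    w * ∫ x in Set.Icc 0 a, Real.exp (-(w * x) ^ 4) = erf4 (a * w) := by
  rw [integral_Icc_eq_integral_Ioc, ← intervalIntegral.integral_of_le ha,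
    intervalIntegral.mul_integral_comp_mul_left (f := fun t => Real.exp (-t ^ 4)), erf4, mul_zero,
    mul_comm w a]

/-- Both sides are four times the integral of `exp(-(w⁴ + x⁴ + y⁴ + z⁴))` over the cone
`0 ≤ x ≤ a w`, `0 ≤ y ≤ b w`, `0 ≤ z ≤ c w`. -/
lemma arctan4_eq_integral_erf4 {a b c : ℝ} (ha : 0 ≤ a) (hb : 0 ≤ b) (hc : 0 ≤ c) :
    arctan4 a b c = 4 * ∫ w in Set.Ioi (0:ℝ),
      Real.exp (-w ^ 4) * (erf4 (a * w) * (erf4 (b * w) * erf4 (c * w))) := by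
  set S := Set.Icc (0:ℝ) a ×ˢ Set.Icc (0:ℝ) b ×ˢ Set.Icc (0:ℝ) c with hS
  let f : ℝ × ℝ × ℝ → ℝ → ℝ := fun p w =>
    w ^ 3 * Real.exp (-(1 + p.1 ^ 4 + p.2.1 ^ 4 + p.2.2 ^ 4) * w ^ 4)
  have hSfin : IsFiniteMeasure (volume.restrict S) :=
    isFiniteMeasure_restrict.2 (isCompact_Icc.prod (isCompact_Icc.prod isCompact_Icc)).measure_ne_top
  have hf : Integrable (Function.uncurry f)
      ((volume.restrict S).prod (volume.restrict (Set.Ioi 0))) := by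
    refine (integrableOn_pow_three_mul_exp_neg_pow_four.integrable.comp_snd
      (volume.restrict S)).mono (Continuous.aestronglyMeasurable (by fun_prop)) (ae_of_all _ ?_)
    rintro ⟨p, w⟩
    simp only [Function.uncurry, f, norm_mul, Real.norm_eq_abs, Real.abs_exp]
    gcongr
    have : 0 ≤ (p.1 ^ 4 + p.2.1 ^ 4 + p.2.2 ^ 4) * w ^ 4 := by positivity
    linarith
  have hleft : ∀ p : ℝ × ℝ × ℝ, 1 / (1 + p.1 ^ 4 + p.2.1 ^ 4 + p.2.2 ^ 4)
      = 4 * ∫ w in Set.Ioi (0:ℝ), f p w := fun p => by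
    rw [integral_pow_three_mul_exp_neg_mul_pow_four (by positivity)]
    ring
  have hright : ∀ w : ℝ, ∫ p in S, f p w
      = Real.exp (-w ^ 4) * (erf4 (a * w) * (erf4 (b * w) * erf4 (c * w))) := fun w => by
    have hfac : ∀ p : ℝ × ℝ × ℝ, f p w = (w ^ 3 * Real.exp (-w ^ 4)) *
        (Real.exp (-(w * p.1) ^ 4) *
          (Real.exp (-(w * p.2.1) ^ 4) * Real.exp (-(w * p.2.2) ^ 4))) := fun p => by
      simp only [f, mul_assoc, ← Real.exp_add]
      ring_nf
    simp_rw [hfac]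
    rw [integral_const_mul, hS, Measure.volume_eq_prod,
      setIntegral_prod_mul (fun x : ℝ => Real.exp (-(w * x) ^ 4))
        (fun q : ℝ × ℝ => Real.exp (-(w * q.1) ^ 4) * Real.exp (-(w * q.2) ^ 4)),
      Measure.volume_eq_prod,
      setIntegral_prod_mul (fun x : ℝ => Real.exp (-(w * x) ^ 4))
        (fun x : ℝ => Real.exp (-(w * x) ^ 4)),
      ← mul_setIntegral_exp_neg_mul_pow_four ha, ← mul_setIntegral_exp_neg_mul_pow_four hb,
      ← mul_setIntegral_exp_neg_mul_pow_four hc]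
    ring
  rw [arctan4]
  simp_rw [hleft, ← hright]
  rw [integral_const_mul, integral_integral_swap hf]

lemma integrableOn_exp_mul_erf4 {k a b c : ℝ} (hk : 0 < k) (ha : 0 ≤ a) (hb : 0 ≤ b)
    (hc : 0 ≤ c) :
    IntegrableOn (fun s => k * Real.exp (-(k * s) ^ 4) *
      (erf4 (a * s) * (erf4 (b * s) * erf4 (c * s)))) (Set.Ioi 0) := by
  have hexp : IntegrableOn (fun s : ℝ => k * Real.exp (-(k * s) ^ 4)) (Set.Ioi 0) := by
    refine Integrable.const_mul ?_ k
    have h := (integrableOn_Ioi_comp_mul_left_iff (fun t : ℝ => Real.exp (-t ^ 4)) 0 hk).2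
    rw [mul_zero] at h
    exact h integrableOn_exp_neg_pow_four
  set C := (1 / 4) * Real.Gamma (1 / 4)
  refine Integrable.mul_bdd (c := C * (C * C)) hexp
    (Continuous.aestronglyMeasurable (by fun_prop)) ?_
  filter_upwards [ae_restrict_mem measurableSet_Ioi] with s (hs : 0 < s)
  rw [norm_mul, norm_mul]
  have h {x : ℝ} (hx : 0 ≤ x) : ‖erf4 (x * s)‖ ≤ C := norm_erf4_le (by positivity)
  have hC : 0 ≤ C := (norm_nonneg _).trans (h ha)
  gcongr <;> exact h ‹_›

lemma arctan4_div_eq_integral_erf4 {k a b c : ℝ} (hk : 0 < k) (ha : 0 ≤ a) (hb : 0 ≤ b)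
    (hc : 0 ≤ c) :
    arctan4 (a / k) (b / k) (c / k) = 4 * ∫ s in Set.Ioi (0:ℝ), k * Real.exp (-(k * s) ^ 4) *
      (erf4 (a * s) * (erf4 (b * s) * erf4 (c * s))) := by
  rw [arctan4_eq_integral_erf4 (by positivity) (by positivity) (by positivity)]
  have h := integral_comp_mul_left_Ioi (fun w : ℝ => Real.exp (-w ^ 4) *
    (erf4 (a / k * w) * (erf4 (b / k * w) * erf4 (c / k * w)))) 0 hk
  have hd (x s : ℝ) : x / k * (k * s) = x * s := by field_simp
  simp only [hd, mul_zero, smul_eq_mul] at h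
  simp only [mul_assoc k]
  rw [integral_const_mul, h, mul_inv_cancel_left₀ hk.ne']

/-- The homogeneous form of the functional equation, in which the four parameters play
symmetric roles. -/
theorem arctan4_homogeneous_functional_equation {k a b c : ℝ} (hk : 0 < k) (ha : 0 < a)
    (hb : 0 < b) (hc : 0 < c) :
    arctan4 (a / k) (b / k) (c / k) + arctan4 (k / a) (b / a) (c / a)
      + arctan4 (a / b) (k / b) (c / b) + arctan4 (a / c) (b / c) (k / c)
      = 4 * ((1 / 4) * Real.Gamma (1 / 4)) ^ 4 := by
  have hi {k a b c : ℝ} (hk : 0 < k) (ha : 0 < a) (hb : 0 < b) (hc : 0 < c) :=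
    integrableOn_exp_mul_erf4 hk ha.le hb.le hc.le
  have I₁ := hi hk ha hb hc
  have I₂ := hi ha hk hb hc
  have I₃ := hi hb ha hk hc
  have I₄ := hi hc ha hb hk
  have key := integral_Ioi_of_hasDerivAt_of_tendsto' (a := 0)
    (f := fun s => erf4 (k * s) * erf4 (a * s) * erf4 (b * s) * erf4 (c * s))
    (fun x _ => ((((hasDerivAt_erf4_mul k x).mul (hasDerivAt_erf4_mul a x)).mul
      (hasDerivAt_erf4_mul b x)).mul (hasDerivAt_erf4_mul c x)).congr_deriv
        (by simp only [Pi.mul_apply, Pi.add_apply]; ring)) (((I₁.add I₂).add I₃).add I₄)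
    (by
      have h {m : ℝ} (hm : 0 < m) := tendsto_erf4.comp (tendsto_id.const_mul_atTop hm)
      exact (((h hk).mul (h ha)).mul (h hb)).mul (h hc))
  rw [integral_add' ((I₁.add I₂).add I₃) I₄, integral_add' (I₁.add I₂) I₃,
    integral_add' I₁ I₂] at key
  simp only [mul_zero, erf4_zero, sub_zero] at key
  rw [arctan4_div_eq_integral_erf4 hk ha.le hb.le hc.le,
    arctan4_div_eq_integral_erf4 ha hk.le hb.le hc.le,
    arctan4_div_eq_integral_erf4 hb ha.le hk.le hc.le,
    arctan4_div_eq_integral_erf4 hc ha.le hb.le hk.le]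
  linear_combination 4 * key

/-- For `u, v > 0`,
`arctan₄(u,v,u/v) + arctan₄(1/u,v/u,1/v) + arctan₄(u/v,1/v,u/v²) + arctan₄(v,v²/u,v/u)
  = 4 · ((1/4)·Γ(1/4))⁴`. -/
theorem arctan4_functional_equation (u v : ℝ) (hu : 0 < u) (hv : 0 < v) :
    arctan4 u v (u / v) + arctan4 (1 / u) (v / u) (1 / v)
      + arctan4 (u / v) (1 / v) (u / v ^ 2)
      + arctan4 v (v ^ 2 / u) (v / u)
      = 4 * ((1 / 4) * Real.Gamma (1 / 4)) ^ 4 := by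
  have h := arctan4_homogeneous_functional_equation one_pos hu hv (div_pos hu hv)
  have h₁ : u / v / u = 1 / v := by field_simp
  have h₂ : u / v / v = u / v ^ 2 := by field_simp
  have h₃ : u / (u / v) = v := by field_simp
  have h₄ : v / (u / v) = v ^ 2 / u := by field_simp
  have h₅ : 1 / (u / v) = v / u := by field_simp
  simpa only [div_one, h₁, h₂, h₃, h₄, h₅] using h
end
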